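/- Let m ≥ 1, 1 < p_j < ∞ for j = 1,…,m, 1/p = Σ_{j=1}^m 1/p_j, and ω⃗ = (ω₁,…,ω_m) ∈ A_{p⃗}^∞(φ) with ν_{ω⃗} = ∏_{j=1}^m ω_j^{p/p_j}. Then there exists some η₀ > 0, depending on p, m, p_j, and a constant C > 0 such that ‖𝓜_{φ,η₀}(f⃗)‖_{L^p(ν_{ω⃗})} ≤ C ∏_{j=1}^m ‖f_j‖_{L^{p_j}(ω_j)} for all f⃗. -/

import Mathlib

open MeasureTheory ENNReal Set Filter

noncomputable section

/-- `ℝⁿ` with the Euclidean norm. -/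
abbrev En (n : ℕ) := EuclideanSpace ℝ (Fin n)

/-- The (closed) cube centered at `x` with sidelength `r`. -/
def cube {n : ℕ} (x : En n) (r : ℝ) : Set (En n) :=
  {y | ∀ i, |y i - x i| ≤ r / 2}

/-- Weighted `L^p` norm `(∫ |f|^p w)^{1/p}` (valued in `ℝ≥0∞`). -/
def wLp {n : ℕ} (p : ℝ) (w f : En n → ℝ) : ℝ≥0∞ :=
  (∫⁻ x, ENNReal.ofReal (|f x| ^ p * w x)) ^ (1 / p)

/-- Weighted weak `L^p` norm `sup_{t>0} t · w({|f|>t})^{1/p}`. -/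
def wLpWeak {n : ℕ} (p : ℝ) (w f : En n → ℝ) : ℝ≥0∞ :=
  ⨆ (t : ℝ) (_ : 0 < t), ENNReal.ofReal t *
    (∫⁻ x in {x | t < |f x|}, ENNReal.ofReal (w x)) ^ (1 / p)

/-- The dilated kernel `K_t(x,y⃗) = t^{-mn} K(x/t, y⃗/t)`. -/
def Kt {n m : ℕ} (K : En n → (Fin m → En n) → ℝ) (t : ℝ) (x : En n)
    (y : Fin m → En n) : ℝ :=
  t ^ (-(m * n : ℝ)) * K (t⁻¹ • x) fun j => t⁻¹ • y j

/-- The multilinear square function associated with the kernel `K`. -/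
def sqOp {n m : ℕ} (K : En n → (Fin m → En n) → ℝ) (f : Fin m → En n → ℝ)
    (x : En n) : ℝ :=
  (∫ t in Ioi (0 : ℝ),
      (∫ y : Fin m → En n, Kt K t x y * ∏ j, f j (y j)) ^ 2 / t) ^ (1 / 2 : ℝ)

/-- Size condition (1.2). -/
def SizeCond (n m : ℕ) (K : En n → (Fin m → En n) → ℝ) : Prop :=
  ∀ N : ℝ, 0 ≤ N → ∃ C > 0, ∀ (y0 : En n) (y : Fin m → En n),
    0 < ∑ j, dist y0 (y j) →
    (∫ t in Ioi (0 : ℝ), (Kt K t y0 y) ^ 2 / t) ^ (1 / 2 : ℝ) ≤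
      C * (∑ j, dist y0 (y j)) ^ (-(m * n : ℝ)) *
        (1 + ∑ j, dist y0 (y j)) ^ (-N)

/-- The cube `Δ_k = Q(y₀, 2^k √(mn) |y₀ - y₀'|)`. -/
def deltaCube {n : ℕ} (m : ℕ) (y0 y0' : En n) (k : ℕ) : Set (En n) :=
  cube y0 (2 ^ k * Real.sqrt (m * n) * dist y0 y0')

/-- The "annulus" `(Δ_{k+2})^m \ (Δ_{k+1})^m`. -/
def annulus {n : ℕ} (m : ℕ) (y0 y0' : En n) (k : ℕ) : Set (Fin m → En n) :=
  {y | ∀ j, y j ∈ deltaCube m y0 y0' (k + 2)} \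
    {y | ∀ j, y j ∈ deltaCube m y0 y0' (k + 1)}

/-- Generalized smoothness condition (1.4) with constants `Ck`. -/
def GenSmoothCond (n m : ℕ) (q q' : ℝ) (Ck : ℕ → ℝ)
    (K : En n → (Fin m → En n) → ℝ) : Prop :=
  ∀ N : ℝ, 0 ≤ N → ∃ C > 0, ∀ (k : ℕ) (y0 y0' : En n), y0 ≠ y0' →
    (∫ t in Ioi (0 : ℝ),
        (∫ y in annulus m y0 y0' k, |Kt K t y0 y - Kt K t y0' y| ^ q) ^ (2 / q)
          / t) ^ (1 / 2 : ℝ) ≤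
      C * Ck k * dist y0 y0' ^ (-(m * n / q')) *
        (1 + 2 ^ k * dist y0 y0') ^ (-N) * (2 : ℝ) ^ (-((k : ℝ) * m * n / q'))

/-- Definition 1.1: a new multilinear square operator with generalized kernel. -/
structure IsGenSquareOp (n m : ℕ) (q q' : ℝ) (Ck : ℕ → ℝ)
    (K : En n → (Fin m → En n) → ℝ) : Prop where
  ck_pos : ∀ k, 0 < Ck k
  size : SizeCond n m K
  smooth : GenSmoothCond n m q q' Ck K
  weak_bound : ∃ s : Fin m → ℝ, (∀ j, 1 ≤ s j ∧ s j ≤ q') ∧ ∃ C > 0,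
    ∀ f : Fin m → En n → ℝ, (∀ j, Measurable (f j)) →
      wLpWeak (∑ j, (s j)⁻¹)⁻¹ (fun _ => 1) (sqOp K f) ≤
        ENNReal.ofReal C * ∏ j, wLp (s j) (fun _ => 1) (f j)

/-- The multiple weight `ν_{ω⃗} = ∏ ω_j^{p/p_j}`. -/
def nuW {n m : ℕ} (p : Fin m → ℝ) (w : Fin m → En n → ℝ) (x : En n) : ℝ :=
  ∏ j, w j x ^ ((∑ i, (p i)⁻¹)⁻¹ / p j)

/-- The multiple weight class `A_{p⃗}^θ(φ)`. -/
def MultiApTheta (n m : ℕ) (p : Fin m → ℝ) (θ : ℝ) (w : Fin m → En n → ℝ) : Prop :=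
  (∀ j x, 0 ≤ w j x) ∧ (∀ j, LocallyIntegrable (w j) volume) ∧
  ∃ C > 0, ∀ (x : En n) (r : ℝ), 0 < r →
    ((ENNReal.ofReal ((1 + r) ^ θ) * volume (cube x r))⁻¹ *
        ∫⁻ y in cube x r, ENNReal.ofReal (nuW p w y)) ^ (∑ i, (p i)⁻¹) *
      ∏ j,
        (if p j = 1 then
          (essInf (fun y => ENNReal.ofReal (w j y)) (volume.restrict (cube x r)))⁻¹
        else
          ((ENNReal.ofReal ((1 + r) ^ θ) * volume (cube x r))⁻¹ *
            ∫⁻ y in cube x r,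
              ENNReal.ofReal (w j y) ^ (1 - p j / (p j - 1))) ^ (1 - (p j)⁻¹))
      ≤ ENNReal.ofReal C



/-- The scalar weight class `A_p^θ(φ)` (with the `ess inf` convention at `p = 1`). -/
def ApTheta (n : ℕ) (p θ : ℝ) (w : En n → ℝ) : Prop :=
  (∀ x, 0 ≤ w x) ∧ LocallyIntegrable w volume ∧
  ∃ C > 0, ∀ (x : En n) (r : ℝ), 0 < r →
    if p = 1 then
      (ENNReal.ofReal ((1 + r) ^ θ) * volume (cube x r))⁻¹ *
          (∫⁻ y in cube x r, ENNReal.ofReal (w y)) ≤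
        ENNReal.ofReal C *
          essInf (fun y => ENNReal.ofReal (w y)) (volume.restrict (cube x r))
    else
      ((ENNReal.ofReal ((1 + r) ^ θ) * volume (cube x r))⁻¹ *
          ∫⁻ y in cube x r, ENNReal.ofReal (w y)) ^ (1 / p) *
        ((ENNReal.ofReal ((1 + r) ^ θ) * volume (cube x r))⁻¹ *
          ∫⁻ y in cube x r, ENNReal.ofReal (w y) ^ (-1 / (p - 1))) ^ (1 - 1 / p) ≤
        ENNReal.ofReal C

/-- Dyadic cube of generation `k` indexed by `v ∈ ℤⁿ`; its sidelength is `2^{-k}`. -/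
def dyadicCube (n : ℕ) (k : ℤ) (v : Fin n → ℤ) : Set (En n) :=
  {y | ∀ i, (v i : ℝ) * 2 ^ (-k) ≤ y i ∧ y i < ((v i : ℝ) + 1) * 2 ^ (-k)}

/-- Average of `f` on `Q`. -/
def cubeAvg {n : ℕ} (Q : Set (En n)) (f : En n → ℝ) : ℝ :=
  (volume Q).toReal⁻¹ * ∫ y in Q, f y

/-- The dyadic maximal function `M^△_{φ,η}`. -/
def dyadicMax (n : ℕ) (η : ℝ) (f : En n → ℝ) (x : En n) : ℝ≥0∞ :=
  ⨆ (k : ℤ) (v : Fin n → ℤ) (_ : x ∈ dyadicCube n k v),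
    (ENNReal.ofReal ((1 + (2 : ℝ) ^ (-k)) ^ η) * volume (dyadicCube n k v))⁻¹ *
      ∫⁻ y in dyadicCube n k v, ENNReal.ofReal |f y|

/-- The dyadic sharp maximal function `M^{♯,△}_{φ,η}`. -/
def sharpMax (n : ℕ) (η : ℝ) (f : En n → ℝ) (x : En n) : ℝ≥0∞ :=
  (⨆ (k : ℤ) (v : Fin n → ℤ) (_ : x ∈ dyadicCube n k v) (_ : (2 : ℝ) ^ (-k) < 1),
      (volume (dyadicCube n k v))⁻¹ *
        ∫⁻ y in dyadicCube n k v,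
          ENNReal.ofReal |f y - cubeAvg (dyadicCube n k v) f|) +
  ⨆ (k : ℤ) (v : Fin n → ℤ) (_ : x ∈ dyadicCube n k v) (_ : 1 ≤ (2 : ℝ) ^ (-k)),
    (ENNReal.ofReal ((1 + (2 : ℝ) ^ (-k)) ^ η) * volume (dyadicCube n k v))⁻¹ *
      ∫⁻ y in dyadicCube n k v, ENNReal.ofReal |f y|

def dyadicMaxDelta (n : ℕ) (δ η : ℝ) (f : En n → ℝ) (x : En n) : ℝ≥0∞ :=
  (dyadicMax n η (fun y => |f y| ^ δ) x) ^ (1 / δ)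

def sharpMaxDelta (n : ℕ) (δ η : ℝ) (f : En n → ℝ) (x : En n) : ℝ≥0∞ :=
  (sharpMax n η (fun y => |f y| ^ δ) x) ^ (1 / δ)

/-- The multilinear maximal operator `𝓜_{φ,η}`. -/
def multiMax (n m : ℕ) (η : ℝ) (f : Fin m → En n → ℝ) (x : En n) : ℝ≥0∞ :=
  ⨆ (c : En n) (r : ℝ) (_ : 0 < r) (_ : x ∈ cube c r),
    ∏ j, (ENNReal.ofReal ((1 + r) ^ η) * volume (cube c r))⁻¹ *
      ∫⁻ y in cube c r, ENNReal.ofReal |f j y|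

def multiMaxDelta (n m : ℕ) (δ η : ℝ) (f : Fin m → En n → ℝ) (x : En n) : ℝ≥0∞ :=
  (multiMax n m η (fun j y => |f j y| ^ δ) x) ^ (1 / δ)

/-- `L^l` "norm" (in `z`) of an `ℝ≥0∞`-valued function, allowing `l = ∞`. -/
def lpFull (n : ℕ) (l : ℝ≥0∞) (g : En n → ℝ≥0∞) : ℝ≥0∞ :=
  if l = ∞ then essSup g volume
  else (∫⁻ z, g z ^ l.toReal) ^ (1 / l.toReal)

/-- Weighted `L^p` norm of `f` restricted to `Q`, i.e. `‖f χ_Q‖_{L^p(w)}`. -/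
def wLpOn {n : ℕ} (Q : Set (En n)) (p : ℝ) (w f : En n → ℝ) : ℝ≥0∞ :=
  (∫⁻ x in Q, ENNReal.ofReal (|f x| ^ p * w x)) ^ (1 / p)

/-- Weighted weak `L^p` norm of `f χ_Q`. -/
def wLpWeakOn {n : ℕ} (Q : Set (En n)) (p : ℝ) (w f : En n → ℝ) : ℝ≥0∞ :=
  ⨆ (t : ℝ) (_ : 0 < t), ENNReal.ofReal t *
    (∫⁻ x in Q ∩ {x | t < |f x|}, ENNReal.ofReal (w x)) ^ (1 / p)

/-- `u(Q) = ∫_Q u`. -/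
def wInt {n : ℕ} (Q : Set (En n)) (u : En n → ℝ) : ℝ≥0∞ :=
  ∫⁻ x in Q, ENNReal.ofReal (u x)

/-- The strong Morrey norm `‖f‖_{M^{p,l}_{α,λ}(u,w)}`. -/
def morreyNorm (n : ℕ) (α lam p : ℝ) (l : ℝ≥0∞) (u w f : En n → ℝ) : ℝ≥0∞ :=
  ⨆ (r : ℝ) (_ : 0 < r), lpFull n l fun z =>
    ENNReal.ofReal ((1 + r) ^ α) * (wInt (cube z r) u) ^ (-lam) *
      wLpOn (cube z r) p w f

/-- The weak Morrey norm `‖f‖_{WM^{p,l}_{α,λ}(u,w)}`. -/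
def weakMorreyNorm (n : ℕ) (α lam p : ℝ) (l : ℝ≥0∞) (u w f : En n → ℝ) : ℝ≥0∞ :=
  ⨆ (r : ℝ) (_ : 0 < r), lpFull n l fun z =>
    ENNReal.ofReal ((1 + r) ^ α) * (wInt (cube z r) u) ^ (-lam) *
      wLpWeakOn (cube z r) p w f

/-- The vector-valued Morrey norm `‖f⃗‖_{M^{p⃗,l}_{α,λ}(u,w⃗)}`. -/
def vecMorreyNorm (n m : ℕ) (α lam : ℝ) (p : Fin m → ℝ) (l : ℝ≥0∞)
    (u : En n → ℝ) (w : Fin m → En n → ℝ) (f : Fin m → En n → ℝ) : ℝ≥0∞ :=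
  ⨆ (r : ℝ) (_ : 0 < r), lpFull n l fun z =>
    ENNReal.ofReal ((1 + r) ^ α) * (wInt (cube z r) u) ^ (-lam) *
      ∏ j, wLpOn (cube z r) (p j) (w j) (f j)

/-- Weighted `L^p` norm of an `ℝ≥0∞`-valued function. -/
def wLpE (n : ℕ) (p : ℝ) (w : En n → ℝ) (g : En n → ℝ≥0∞) : ℝ≥0∞ :=
  (∫⁻ x, g x ^ p * ENNReal.ofReal (w x)) ^ (1 / p)

/-- Weighted weak `L^p` norm of an `ℝ≥0∞`-valued function. -/
def wLpWeakE (n : ℕ) (p : ℝ) (w : En n → ℝ) (g : En n → ℝ≥0∞) : ℝ≥0∞ :=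
  ⨆ (t : ℝ) (_ : 0 < t), ENNReal.ofReal t *
    (∫⁻ x in {x | ENNReal.ofReal t < g x}, ENNReal.ofReal (w x)) ^ (1 / p)


structure IsGrid {X ι : Type*} [MeasurableSpace X] (Q : ι → Set X) (lev : ι → ℕ) : Prop where
  meas : ∀ a, MeasurableSet (Q a)
  nested : ∀ a b, lev a ≤ lev b → Q b ⊆ Q a ∨ Disjoint (Q a) (Q b)
  same : ∀ a b, lev a = lev b → a ≠ b → Disjoint (Q a) (Q b)

/-- maximal elements -/
def gridMax {X ι : Type*} (Q : ι → Set X) (lev : ι → ℕ) (P : Set ι) : Set ι :=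
  {a | a ∈ P ∧ ∀ b ∈ P, lev b < lev a → Disjoint (Q a) (Q b)}

lemma gridMax_disj {X ι : Type*} [MeasurableSpace X] {Q : ι → Set X} {lev : ι → ℕ}
    (hG : IsGrid Q lev) (P : Set ι) : (gridMax Q lev P).PairwiseDisjoint Q := by
  intro a ha b hb hab
  rcases lt_trichotomy (lev a) (lev b) with h | h | h
  · exact (hb.2 a ha.1 h).symm
  · exact hG.same a b h hab
  · exact ha.2 b hb.1 h

lemma gridMax_union {X ι : Type*} [MeasurableSpace X] {Q : ι → Set X} {lev : ι → ℕ}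
    (hG : IsGrid Q lev) (P : Set ι) : ⋃ a ∈ gridMax Q lev P, Q a = ⋃ a ∈ P, Q a := by
  apply Subset.antisymm
  · exact biUnion_subset_biUnion_left fun a ha => ha.1
  · have key : ∀ k : ℕ, ∀ a ∈ P, lev a = k → Q a ⊆ ⋃ a ∈ gridMax Q lev P, Q a := by
      intro k
      induction k using Nat.strong_induction_on with
      | _ k ih =>
        intro a ha hk
        by_cases h : a ∈ gridMax Q lev P
        · exact subset_biUnion_of_mem (u := Q) h
        · have : ∃ b ∈ P, lev b < lev a ∧ ¬ Disjoint (Q a) (Q b) := by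
            by_contra hc
            push Not at hc
            exact h ⟨ha, fun b hb hl => hc b hb hl⟩
          obtain ⟨b, hb, hl, hd⟩ := this
          have h1 : Q a ⊆ Q b := by
            rcases hG.nested b a hl.le with h2 | h2
            · exact h2
            · exact absurd h2.symm hd
          exact h1.trans (ih (lev b) (hk ▸ hl) b hb rfl)
    exact iUnion₂_subset fun a ha => key _ a ha rfl

lemma holder_tsum {ι κ : Type*} [Fintype κ] (f : κ → ι → ℝ≥0∞) (r : κ → ℝ)
    (hr : ∑ i, r i = 1) (hr0 : ∀ i, 0 ≤ r i) :
    ∑' a, ∏ i, f i a ^ r i ≤ ∏ i, (∑' a, f i a) ^ r i := by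
  let _ : MeasurableSpace ι := ⊤
  have := ENNReal.lintegral_prod_norm_pow_le (μ := (Measure.count : Measure ι)) Finset.univ
    (f := f) (fun i _ => (measurable_from_top).aemeasurable) hr (fun i _ => hr0 i)
  simpa [lintegral_count] using this

lemma grid_weak {X ι κ : Type*} [MeasurableSpace X] [Countable ι] [Fintype κ]
    {Q : ι → Set X} {lev : ι → ℕ} (hG : IsGrid Q lev) (μ ρ : Measure X) (P : Set ι)
    (f : κ → X → ℝ≥0∞) (r : κ → ℝ) (hr : ∑ i, r i = 1) (hr0 : ∀ i, 0 ≤ r i) (t : ℝ≥0∞)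
    (h : ∀ a ∈ P, t * μ (Q a) ≤ ∏ i, (∫⁻ x in Q a, f i x ∂ρ) ^ r i) :
    t * μ (⋃ a ∈ P, Q a) ≤ ∏ i, (∫⁻ x in ⋃ a ∈ P, Q a, f i x ∂ρ) ^ r i := by
  rw [← gridMax_union hG P]
  set S := gridMax Q lev P with hS
  have hd : S.PairwiseDisjoint Q := gridMax_disj hG P
  have hc : S.Countable := S.to_countable
  rw [measure_biUnion hc hd (fun a _ => hG.meas a), ← ENNReal.tsum_mul_left]
  calc ∑' a : S, t * μ (Q a) ≤ ∑' a : S, ∏ i, (∫⁻ x in Q a, f i x ∂ρ) ^ r i :=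
        ENNReal.tsum_le_tsum fun a => h a a.2.1
    _ ≤ ∏ i, (∑' a : S, ∫⁻ x in Q a, f i x ∂ρ) ^ r i := holder_tsum _ r hr hr0
    _ = _ := by
        congr 1; ext i
        rw [lintegral_biUnion hc (fun a _ => hG.meas a) hd]

/-- Dyadic-type maximal function. -/
def gMax {X ι : Type*} [MeasurableSpace X] (Q : ι → Set X) (μ : Measure X)
    (g : X → ℝ≥0∞) (x : X) : ℝ≥0∞ :=
  ⨆ (a : ι) (_ : x ∈ Q a), (μ (Q a))⁻¹ * ∫⁻ y in Q a, g y ∂μ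

lemma gMax_gt {X ι : Type*} [MeasurableSpace X] (Q : ι → Set X) (μ : Measure X)
    (g : X → ℝ≥0∞) (t : ℝ≥0∞) :
    {x | t < gMax Q μ g x} = ⋃ a ∈ {a | t < (μ (Q a))⁻¹ * ∫⁻ y in Q a, g y ∂μ}, Q a := by
  ext x
  simp only [gMax, lt_iSup_iff, mem_ofPred_eq, mem_iUnion, exists_prop]
  constructor
  · rintro ⟨a, h1, h2⟩; exact ⟨a, h2, h1⟩
  · rintro ⟨a, h1, h2⟩; exact ⟨a, h2, h1⟩

lemma gMax_meas {X ι : Type*} [MeasurableSpace X] [Countable ι] {Q : ι → Set X} {lev : ι → ℕ}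
    (hG : IsGrid Q lev) (μ : Measure X) (g : X → ℝ≥0∞) : Measurable (gMax Q μ g) := by
  refine measurable_of_Ioi fun t => ?_
  change MeasurableSet {x | t < gMax Q μ g x}
  rw [gMax_gt]
  exact MeasurableSet.biUnion (to_countable _) fun a _ => hG.meas a

lemma gMax_weak {X ι : Type*} [MeasurableSpace X] [Countable ι] {Q : ι → Set X} {lev : ι → ℕ}
    (hG : IsGrid Q lev) (μ : Measure X) (g : X → ℝ≥0∞) (t : ℝ≥0∞) :
    t * μ {x | t < gMax Q μ g x} ≤ ∫⁻ x, g x ∂μ := by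
  rw [gMax_gt]
  have := grid_weak hG μ μ {a | t < (μ (Q a))⁻¹ * ∫⁻ y in Q a, g y ∂μ}
    (fun _ : Unit => g) (fun _ => 1) (by simp) (by simp) t (by
      intro a ha
      simp only [Finset.univ_unique, Finset.prod_const, Finset.card_singleton, pow_one,
        ENNReal.rpow_one]
      simp only [mem_ofPred_eq] at ha
      have ha' := ha.le
      rw [mul_comm, ← div_eq_mul_inv] at ha'
      exact ENNReal.mul_le_of_le_div ha')
  simp only [Finset.univ_unique, Finset.prod_const, Finset.card_singleton, pow_one,
        ENNReal.rpow_one] at this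
  exact this.trans (setLIntegral_le_lintegral _ _)

lemma gMax_weak2 {X ι : Type*} [MeasurableSpace X] [Countable ι] {Q : ι → Set X} {lev : ι → ℕ}
    (hG : IsGrid Q lev) (μ : Measure X) (g : X → ℝ≥0∞) (hg : Measurable g) (t : ℝ≥0∞) :
    t * μ {x | 2 * t < gMax Q μ g x} ≤ ∫⁻ x in {x | t < g x}, g x ∂μ := by
  have hm : MeasurableSet {x | t < g x} := hg measurableSet_Ioi
  rw [← lintegral_indicator hm]
  refine le_trans ?_ (gMax_weak hG μ _ t)
  refine mul_le_mul_right (measure_mono ?_) t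
  intro x hx
  simp only [mem_ofPred_eq] at hx ⊢
  by_contra hc
  push Not at hc
  have : gMax Q μ g x ≤ gMax Q μ ({x | t < g x}.indicator g) x + t := by
    refine iSup₂_le fun a ha => ?_
    calc (μ (Q a))⁻¹ * ∫⁻ y in Q a, g y ∂μ
        ≤ (μ (Q a))⁻¹ * (∫⁻ y in Q a, ({x | t < g x}.indicator g) y + t ∂μ) := by
          gcongr with y
          by_cases h : t < g y
          · rw [indicator_of_mem (by exact h)]; exact le_self_add
          · rw [indicator_of_notMem (by exact h)]; simpa using h
      _ = (μ (Q a))⁻¹ * (∫⁻ y in Q a, ({x | t < g x}.indicator g) y ∂μ) +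
            (μ (Q a))⁻¹ * (t * μ (Q a)) := by
          rw [lintegral_add_right _ measurable_const, mul_add]
          simp
      _ ≤ _ := by
          gcongr
          · exact le_iSup₂_of_le a ha le_rfl
          · rw [mul_comm t, ← mul_assoc]
            calc _ ≤ 1 * t := by gcongr; exact ENNReal.inv_mul_le_one _
              _ = t := one_mul _
  have h3 : gMax Q μ g x ≤ 2 * t := this.trans (by rw [two_mul]; gcongr)
  exact absurd hx (not_lt.2 h3)

def cMax (q : ℝ) : ℝ≥0∞ := ENNReal.ofReal (2 * q / (q - 1) * 2 ^ (q-1))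

lemma gMax_strong {X ι : Type*} [MeasurableSpace X] [Countable ι] {Q : ι → Set X} {lev : ι → ℕ}
    (hG : IsGrid Q lev) (μ : Measure X) (g : X → ℝ≥0∞) (hg : Measurable g)
    (hgt : ∀ x, g x ≠ ⊤) (q : ℝ) (hq : 1 < q) :
    ∫⁻ x, gMax Q μ g x ^ q ∂μ ≤ cMax q * ∫⁻ x, g x ^ q ∂μ := by
  have hq0 : 0 < q := by linarith
  have hM := gMax_meas hG μ g
  -- truncated
  have trunc : ∀ N : ℕ, ∫⁻ x, (min (gMax Q μ g x) N) ^ q ∂μ ≤ cMax q * ∫⁻ x, g x ^ q ∂μ := by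
    intro N
    set F : X → ℝ := fun x => (min (gMax Q μ g x) N).toReal with hF
    have hFt : ∀ x, min (gMax Q μ g x) N ≠ ⊤ := fun x =>
      ne_top_of_le_ne_top (ENNReal.natCast_ne_top N) (min_le_right _ _)
    have e1 : ∫⁻ x, (min (gMax Q μ g x) N) ^ q ∂μ = ∫⁻ x, ENNReal.ofReal (F x ^ q) ∂μ := by
      refine lintegral_congr fun x => ?_
      rw [← ENNReal.ofReal_rpow_of_nonneg ENNReal.toReal_nonneg hq0.le,
        ENNReal.ofReal_toReal (hFt x)]
    rw [e1, lintegral_rpow_eq_lintegral_meas_lt_mul μ (ae_of_all _ fun x => ENNReal.toReal_nonneg)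
      ((hM.min measurable_const).ennreal_toReal.aemeasurable) hq0]
    set ρ := μ.withDensity g with hρ
    have e2 : ∀ t ∈ Ioi (0:ℝ), μ {a | t < F a} * ENNReal.ofReal (t ^ (q - 1)) ≤
        2 * (ρ {a | t < 2 * (g a).toReal} * ENNReal.ofReal (t ^ (q - 1 - 1))) := by
      intro t ht
      have ht' : (0:ℝ) < t := ht
      have h1 : μ {a | t < F a} ≤ μ {x | 2 * ENNReal.ofReal (t/2) < gMax Q μ g x} := by
        apply measure_mono
        intro x hx
        simp only [mem_ofPred_eq] at hx ⊢
        have : 2 * ENNReal.ofReal (t/2) = ENNReal.ofReal t := by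
          rw [show (2:ℝ≥0∞) = ENNReal.ofReal 2 by simp, ← ENNReal.ofReal_mul (by norm_num)]
          congr 1; ring
        rw [this]
        have := (ENNReal.ofReal_lt_iff_lt_toReal ht'.le (hFt x)).2 hx
        exact this.trans_le (min_le_left _ _)
      have h2 := gMax_weak2 hG μ g hg (ENNReal.ofReal (t/2))
      have h3 : ∫⁻ x in {x | ENNReal.ofReal (t/2) < g x}, g x ∂μ = ρ {a | t < 2 * (g a).toReal} := by
        have : {x | ENNReal.ofReal (t/2) < g x} = {a | t < 2 * (g a).toReal} := by
          ext x
          simp only [mem_ofPred_eq]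
          rw [ENNReal.ofReal_lt_iff_lt_toReal (by positivity) (hgt x)]
          constructor <;> intro h <;> linarith
        rw [hρ, withDensity_apply _ ?_, this]
        rw [← this]; exact hg measurableSet_Ioi
      rw [h3] at h2
      have h4 : ENNReal.ofReal (t ^ (q-1)) = 2 * ENNReal.ofReal (t/2) * ENNReal.ofReal (t ^ (q-1-1)) := by
        rw [show (2:ℝ≥0∞) = ENNReal.ofReal 2 by simp, ← ENNReal.ofReal_mul (by norm_num),
          ← ENNReal.ofReal_mul (by positivity)]
        congr 1
        rw [Real.rpow_sub_one ht'.ne' (q-1)]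
        field_simp
      rw [h4]
      calc _ ≤ μ {x | 2 * ENNReal.ofReal (t/2) < gMax Q μ g x} * (2 * ENNReal.ofReal (t/2) * ENNReal.ofReal (t ^ (q-1-1))) := by
            gcongr
        _ = 2 * ((ENNReal.ofReal (t/2) * μ {x | 2 * ENNReal.ofReal (t/2) < gMax Q μ g x}) *
              ENNReal.ofReal (t ^ (q-1-1))) := by ring
        _ ≤ _ := by gcongr
    calc _ ≤ ENNReal.ofReal q * ∫⁻ t in Ioi (0:ℝ), 2 * (ρ {a | t < 2 * (g a).toReal} * ENNReal.ofReal (t ^ (q - 1 - 1))) := by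
          gcongr 1
          exact setLIntegral_mono' measurableSet_Ioi e2
      _ = ENNReal.ofReal (2 * q / (q-1)) * (ENNReal.ofReal (q-1) * ∫⁻ t in Ioi (0:ℝ), (ρ {a | t < 2 * (g a).toReal} * ENNReal.ofReal (t ^ (q - 1 - 1)))) := by
          rw [lintegral_const_mul' _ _ (by simp), ← mul_assoc, ← mul_assoc]
          congr 1
          rw [show (2:ℝ≥0∞) = ENNReal.ofReal 2 by simp, ← ENNReal.ofReal_mul hq0.le,
            ← ENNReal.ofReal_mul (by apply div_nonneg <;> linarith)]
          congr 1
          have : q - 1 ≠ 0 := by linarith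
          field_simp
      _ = ENNReal.ofReal (2 * q / (q-1)) * ∫⁻ x, ENNReal.ofReal ((2 * (g x).toReal) ^ (q-1)) ∂ρ := by
          rw [lintegral_rpow_eq_lintegral_meas_lt_mul ρ (ae_of_all _ fun x => by
              simp only [Pi.zero_apply]; positivity)
            ((hg.ennreal_toReal.const_mul 2).aemeasurable) (by linarith)]
      _ = cMax q * ∫⁻ x, g x ^ q ∂μ := by
          rw [hρ, lintegral_withDensity_eq_lintegral_mul _ hg (by fun_prop), cMax,
            ENNReal.ofReal_mul (by apply div_nonneg <;> linarith), mul_assoc]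
          congr 1
          rw [← lintegral_const_mul _ (by fun_prop)]
          refine lintegral_congr fun x => ?_
          have : g x ^ q = g x * g x ^ (q-1) := by
            nth_rw 2 [← ENNReal.rpow_one (g x)]
            rw [← ENNReal.rpow_add_of_nonneg _ _ (by norm_num) (by linarith)]
            congr 1; ring
          simp only [Pi.mul_apply]
          rw [this, Real.mul_rpow (by norm_num) ENNReal.toReal_nonneg,
            ENNReal.ofReal_mul (by positivity),
            ← ENNReal.ofReal_rpow_of_nonneg ENNReal.toReal_nonneg (by linarith),
            ENNReal.ofReal_toReal (hgt x)]
          ring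
  have hsup : ∀ x, gMax Q μ g x ^ q = ⨆ N : ℕ, (min (gMax Q μ g x) N) ^ q := by
    intro x
    have : gMax Q μ g x = ⨆ N : ℕ, min (gMax Q μ g x) N := by
      rw [← inf_iSup_eq, ENNReal.iSup_natCast, inf_top_eq]
    conv_lhs => rw [this]
    exact (ENNReal.orderIsoRpow q hq0).map_iSup _
  simp_rw [hsup]
  rw [lintegral_iSup]
  · exact iSup_le trunc
  · intro N; exact (hM.min measurable_const).pow_const q
  · intro N M hNM x
    dsimp only
    gcongr

/-- product of averages over a grid set -/
def gAvg {X ι : Type*} [MeasurableSpace X] {m : ℕ} (Q : ι → Set X) (μ : Measure X)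
    (f : Fin m → X → ℝ≥0∞) (a : ι) : ℝ≥0∞ :=
  ∏ j, (μ (Q a))⁻¹ * ∫⁻ y in Q a, f j y ∂μ

/-- The exceptional part. -/
def gBad {X ι : Type*} [MeasurableSpace X] {m : ℕ} (Q : ι → Set X) (μ : Measure X)
    (f : Fin m → X → ℝ≥0∞) (a : ι) : Set ι :=
  {b | Q b ⊆ Q a ∧ 2 ^ m * gAvg Q μ f a < gAvg Q μ f b}

def gE {X ι : Type*} [MeasurableSpace X] {m : ℕ} (Q : ι → Set X) (μ : Measure X)
    (f : Fin m → X → ℝ≥0∞) (a : ι) : Set X :=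
  Q a \ ⋃ b ∈ gBad Q μ f a, Q b

lemma gE_meas {X ι : Type*} [MeasurableSpace X] [Countable ι] {Q : ι → Set X} {lev : ι → ℕ}
    (hG : IsGrid Q lev) (μ : Measure X) {m : ℕ} (f : Fin m → X → ℝ≥0∞) (a : ι) : MeasurableSet (gE Q μ f a) :=
  (hG.meas a).diff (MeasurableSet.biUnion (to_countable _) fun b _ => hG.meas b)

lemma gBad_meas {X ι : Type*} [MeasurableSpace X] [Countable ι] {Q : ι → Set X} {lev : ι → ℕ}
    (hG : IsGrid Q lev) (μ : Measure X) {m : ℕ} (hm : 1 ≤ m) (f : Fin m → X → ℝ≥0∞)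
    (hv0 : ∀ a, μ (Q a) ≠ 0) (hvt : ∀ a, μ (Q a) ≠ ⊤)
    (hfin : ∀ a j, ∫⁻ y in Q a, f j y ∂μ ≠ ⊤) (a : ι) (ha : gAvg Q μ f a ≠ 0) :
    2 * μ (⋃ b ∈ gBad Q μ f a, Q b) ≤ μ (Q a) := by
  have hm0 : (0:ℝ) < m := by exact_mod_cast hm
  have hform : ∀ b, gAvg Q μ f b * μ (Q b) ^ m = ∏ j, ∫⁻ y in Q b, f j y ∂μ := by
    intro b
    rw [gAvg, Finset.prod_mul_distrib, Finset.prod_const, Finset.card_univ, Fintype.card_fin,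
      mul_right_comm, ← mul_pow, ENNReal.inv_mul_cancel (hv0 b) (hvt b), one_pow, one_mul]
  have hat : gAvg Q μ f a ≠ ⊤ := by
    refine ENNReal.prod_ne_top fun j _ => ENNReal.mul_ne_top (by simp [hv0]) (hfin a j)
  set t : ℝ≥0∞ := 2 * gAvg Q μ f a ^ (m:ℝ)⁻¹ with ht
  have hroot : ∀ x : ℝ≥0∞, (x ^ m) ^ (m:ℝ)⁻¹ = x := by
    intro x
    rw [← ENNReal.rpow_natCast, ENNReal.rpow_rpow_inv hm0.ne']
  have htpow : t = (2 ^ m * gAvg Q μ f a) ^ (m:ℝ)⁻¹ := by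
    rw [ENNReal.mul_rpow_of_nonneg _ _ (by positivity), hroot]
  have h1 := grid_weak hG μ μ (gBad Q μ f a) f (fun _ => (m:ℝ)⁻¹)
    (by simp [hm0.ne']) (fun _ => by positivity) t (by
      intro b hb
      rw [ENNReal.prod_rpow_of_nonneg (by positivity), ← hform b,
        ENNReal.mul_rpow_of_nonneg _ _ (by positivity), hroot, htpow]
      have := hb.2.le
      gcongr)
  have h2 : ∏ i, (∫⁻ x in ⋃ b ∈ gBad Q μ f a, Q b, f i x ∂μ) ^ (m:ℝ)⁻¹ ≤
      gAvg Q μ f a ^ (m:ℝ)⁻¹ * μ (Q a) := by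
    calc _ ≤ ∏ i, (∫⁻ x in Q a, f i x ∂μ) ^ (m:ℝ)⁻¹ := by
          gcongr with i
          exact iUnion₂_subset fun b hb => hb.1
      _ = _ := by
          rw [ENNReal.prod_rpow_of_nonneg (by positivity), ← hform a,
            ENNReal.mul_rpow_of_nonneg _ _ (by positivity), hroot]
  have h3 := h1.trans h2
  rw [ht, mul_comm 2, mul_assoc] at h3
  refine (ENNReal.mul_le_mul_iff_right ?_ ?_).1 h3
  · simp [ENNReal.rpow_eq_zero_iff, ha, hat]
  · exact ENNReal.rpow_ne_top_of_nonneg (by positivity) hat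

lemma gE_large {X ι : Type*} [MeasurableSpace X] [Countable ι] {Q : ι → Set X} {lev : ι → ℕ}
    (hG : IsGrid Q lev) (μ : Measure X) {m : ℕ} (hm : 1 ≤ m) (f : Fin m → X → ℝ≥0∞)
    (hv0 : ∀ a, μ (Q a) ≠ 0) (hvt : ∀ a, μ (Q a) ≠ ⊤)
    (hfin : ∀ a j, ∫⁻ y in Q a, f j y ∂μ ≠ ⊤) (a : ι) (ha : gAvg Q μ f a ≠ 0) :
    μ (Q a) ≤ 2 * μ (gE Q μ f a) := by
  have h1 := gBad_meas hG μ hm f hv0 hvt hfin a ha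
  set B := ⋃ b ∈ gBad Q μ f a, Q b with hB
  have hBm : MeasurableSet B := MeasurableSet.biUnion (to_countable _) fun b _ => hG.meas b
  have hsub : B ⊆ Q a := iUnion₂_subset fun b hb => hb.1
  have h2 : μ (Q a) = μ B + μ (gE Q μ f a) := by
    rw [gE, ← hB, ← measure_inter_add_sdiff (Q a) hBm, inter_eq_self_of_subset_right hsub]
  have hBt : μ B ≠ ⊤ := ne_top_of_le_ne_top (hvt a) (measure_mono hsub)
  have h3 : 2 * μ B ≤ μ B + μ (gE Q μ f a) := h1.trans h2.le
  rw [two_mul] at h3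
  have h4 : μ B ≤ μ (gE Q μ f a) := (ENNReal.add_le_add_iff_left hBt).1 h3
  rw [h2, two_mul]
  gcongr

lemma sum_parity {X ι : Type*} [MeasurableSpace X] [Countable ι] (μ : Measure X) (E : ι → Set X)
    (hE : ∀ a, MeasurableSet (E a)) (S : Set ι) (k : ι → ℤ)
    (hd : ∀ a ∈ S, ∀ b ∈ S, a ≠ b → (k a) % 2 = (k b) % 2 → Disjoint (E a) (E b))
    (h : X → ℝ≥0∞) :
    ∑' a : S, ∫⁻ x in E a, h x ∂μ ≤ 2 * ∫⁻ x, h x ∂μ := by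
  have key : ∀ e : ℤ, ∑' a : {a | a ∈ S ∧ k a % 2 = e}, ∫⁻ x in E a, h x ∂μ ≤ ∫⁻ x, h x ∂μ := by
    intro e
    rw [← lintegral_biUnion (to_countable _) (fun a _ => hE a)]
    · exact setLIntegral_le_lintegral _ _
    · intro a ha b hb hab
      exact hd a ha.1 b hb.1 hab (ha.2.trans hb.2.symm)
  have hS : S = {a | a ∈ S ∧ k a % 2 = 0} ∪ {a | a ∈ S ∧ k a % 2 = 1} := by
    ext a
    simp only [mem_union, mem_ofPred_eq]
    rcases Int.emod_two_eq_zero_or_one (k a) with h | h <;> simp [h]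
  calc ∑' a : S, ∫⁻ x in E a, h x ∂μ
      = ∑' a : ↑({a | a ∈ S ∧ k a % 2 = 0} ∪ {a | a ∈ S ∧ k a % 2 = 1}), ∫⁻ x in E a, h x ∂μ := by
        rw [← hS]
    _ ≤ _ := ENNReal.tsum_union_le (fun a => ∫⁻ x in E a, h x ∂μ) _ _
    _ ≤ _ := by rw [two_mul]; exact add_le_add (key 0) (key 1)

lemma records {X ι : Type*} [MeasurableSpace X] [Countable ι] {Q : ι → Set X} {lev : ι → ℕ}
    (hG : IsGrid Q lev) (μ : Measure X) {m : ℕ} (hm : 1 ≤ m) (f : Fin m → X → ℝ≥0∞)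
    (hv0 : ∀ a, μ (Q a) ≠ 0)
    (hfin : ∀ a, gAvg Q μ f a ≠ ⊤) :
    ∃ (S : Set ι) (k : ι → ℤ), (∀ a ∈ S, gAvg Q μ f a ≠ 0) ∧
      (∀ a ∈ S, ∀ b ∈ S, a ≠ b → (k a) % 2 = (k b) % 2 →
        Disjoint (gE Q μ f a) (gE Q μ f b)) ∧
      ∀ a x, x ∈ Q a → gAvg Q μ f a ≠ 0 →
        ∃ b ∈ S, x ∈ Q b ∧ gAvg Q μ f a ≤ 2 ^ m * gAvg Q μ f b := by
  set lam := gAvg Q μ f with hlam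
  set A : ℝ≥0∞ := 2 ^ m with hA
  have hA1 : 1 < A := one_lt_pow₀ (by norm_num) (by omega)
  have hAt : A ≠ ⊤ := by simp [hA]
  have hA0 : A ≠ 0 := by simp [hA]
  have hex : ∀ a, ∃ k : ℤ, lam a ≠ 0 → A ^ k < lam a ∧ lam a ≤ A ^ (k+1) := by
    intro a
    by_cases h : lam a = 0
    · exact ⟨0, fun h' => absurd h h'⟩
    · obtain ⟨k, hk⟩ := ENNReal.exists_mem_Ioc_zpow h (hfin a) hA1 hAt
      exact ⟨k, fun _ => hk⟩
  choose k hk using hex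
  have hne : ∀ a, (Q a).Nonempty := fun a => nonempty_of_measure_ne_zero (hv0 a)
  refine ⟨{a | lam a ≠ 0 ∧ ∀ b, lam b ≠ 0 → lev b < lev a → Q a ⊆ Q b → k b < k a}, k,
    fun a ha => ha.1, ?_, ?_⟩
  · -- disjointness
    have main : ∀ a ∈ {a | lam a ≠ 0 ∧ ∀ b, lam b ≠ 0 → lev b < lev a → Q a ⊆ Q b → k b < k a},
        ∀ b ∈ {a | lam a ≠ 0 ∧ ∀ b, lam b ≠ 0 → lev b < lev a → Q a ⊆ Q b → k b < k a},
        lev a < lev b → (k a) % 2 = (k b) % 2 → Disjoint (gE Q μ f a) (gE Q μ f b) := by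
      intro a ha b hb hl hpar
      rw [Set.disjoint_left]
      intro x hxa hxb
      have hsub : Q b ⊆ Q a := by
        rcases hG.nested a b hl.le with h | h
        · exact h
        · exact absurd hxb.1 (Set.disjoint_left.1 h hxa.1)
      have h1 := hb.2 a ha.1 hl hsub
      have h2 : k a + 1 + 1 ≤ k b := by omega
      apply hxa.2
      simp only [mem_iUnion]
      refine ⟨b, ⟨hsub, ?_⟩, hxb.1⟩
      calc A * lam a ≤ A * A ^ (k a + 1) := by gcongr; exact (hk a ha.1).2
        _ = A ^ (k a + 1 + 1) := by
            rw [ENNReal.zpow_add hA0 hAt (k a + 1) 1, zpow_one, mul_comm]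
        _ ≤ A ^ (k b) := ENNReal.zpow_le_of_le hA1.le h2
        _ < lam b := (hk b hb.1).1
    intro a ha b hb hab hpar
    rcases lt_trichotomy (lev a) (lev b) with h | h | h
    · exact main a ha b hb h hpar
    · exact (hG.same a b h hab).mono sdiff_subset sdiff_subset
    · exact (main b hb a ha h hpar.symm).symm
  · intro a x hx ha
    have key : ∀ N : ℕ, ∀ b, lev b = N → x ∈ Q b → lam b ≠ 0 → k a ≤ k b →
        ∃ c ∈ {a | lam a ≠ 0 ∧ ∀ b, lam b ≠ 0 → lev b < lev a → Q a ⊆ Q b → k b < k a},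
          x ∈ Q c ∧ k a ≤ k c := by
      intro N
      induction N using Nat.strong_induction_on with
      | _ N ih =>
        intro b hbN hxb hb0 hkb
        by_cases h : ∀ c, lam c ≠ 0 → lev c < lev b → Q b ⊆ Q c → k c < k b
        · exact ⟨b, ⟨hb0, h⟩, hxb, hkb⟩
        · push Not at h
          obtain ⟨c, hc0, hcl, hcs, hck⟩ := h
          exact ih (lev c) (hbN ▸ hcl) c rfl (hcs hxb) hc0 (hkb.trans hck)
    obtain ⟨c, hc, hxc, hkc⟩ := key _ a rfl hx ha le_rfl
    refine ⟨c, hc, hxc, ?_⟩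
    calc lam a ≤ A ^ (k a + 1) := (hk a ha).2
      _ ≤ A ^ (k c + 1) := ENNReal.zpow_le_of_le hA1.le (by omega)
      _ = A * A ^ (k c) := by rw [ENNReal.zpow_add hA0 hAt, zpow_one, mul_comm]
      _ ≤ A * lam c := by gcongr; exact (hk c hc.1).1.le

lemma holder_E {X : Type*} [MeasurableSpace X] (μ : Measure X) {m : ℕ} (hm : 1 ≤ m)
    (q : Fin m → ℝ) (hq : ∀ j, 1 < q j) (ν : X → ℝ≥0∞) (σ : Fin m → X → ℝ≥0∞)
    (hν : Measurable ν) (hσ : ∀ j, Measurable (σ j))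
    (h1 : ∀ᵐ x ∂μ, 1 ≤ ν x ^ (∑ i, (q i)⁻¹) * ∏ j, σ j x ^ (1 - (q j)⁻¹)) (E : Set X) :
    μ E ^ m ≤ (∫⁻ x in E, ν x ∂μ) ^ (∑ i, (q i)⁻¹) *
      ∏ j, (∫⁻ x in E, σ j x ∂μ) ^ (1 - (q j)⁻¹) := by
  have hm0 : (0:ℝ) < m := by exact_mod_cast hm
  have hqi : ∀ j, 0 ≤ 1 - (q j)⁻¹ := fun j => by
    have := inv_le_one_of_one_le₀ (hq j).le; linarith
  have hP : 0 ≤ ∑ i, (q i)⁻¹ := Finset.sum_nonneg fun i _ => by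
    have := hq i; positivity
  let F : Option (Fin m) → X → ℝ≥0∞ := fun o => o.elim ν σ
  let r : Option (Fin m) → ℝ := fun o => o.elim ((∑ i, (q i)⁻¹) * (m:ℝ)⁻¹) (fun j => (1 - (q j)⁻¹) * (m:ℝ)⁻¹)
  have hr : ∑ o, r o = 1 := by
    rw [Fintype.sum_option]
    simp only [r, Option.elim]
    rw [← Finset.sum_mul, ← add_mul, Finset.sum_sub_distrib]
    simp [hm0.ne']
  have H := ENNReal.lintegral_prod_norm_pow_le (μ := μ.restrict E) Finset.univ (f := F) (p := r)
    (by rintro (_ | j) _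
        · exact hν.aemeasurable
        · exact (hσ j).aemeasurable) hr
    (by rintro (_ | j) _
        · exact mul_nonneg hP (by positivity)
        · exact mul_nonneg (hqi j) (by positivity))
  simp only [Fintype.prod_option] at H
  simp only [F, r, Option.elim, ENNReal.rpow_mul] at H
  have H2 : μ E ≤ ∫⁻ a in E, (ν a ^ ∑ i, (q i)⁻¹) ^ (m:ℝ)⁻¹ * ∏ x, (σ x a ^ (1 - (q x)⁻¹)) ^ (m:ℝ)⁻¹ ∂μ := by
    rw [← setLIntegral_one]
    refine lintegral_mono_ae ?_
    filter_upwards [ae_restrict_of_ae h1] with x hx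
    rw [ENNReal.prod_rpow_of_nonneg (by positivity), ← ENNReal.mul_rpow_of_nonneg _ _ (by positivity)]
    exact ENNReal.one_le_rpow hx (by positivity)
  have H3 := H2.trans H
  rw [ENNReal.prod_rpow_of_nonneg (by positivity), ← ENNReal.mul_rpow_of_nonneg _ _ (by positivity)] at H3
  calc μ E ^ m ≤ _ := pow_le_pow_left' H3 m
    _ = _ := by rw [← ENNReal.rpow_natCast, ENNReal.rpow_inv_rpow hm0.ne']

lemma sigma_E {X : Type*} [MeasurableSpace X] (μ : Measure X) {m : ℕ} (hm : 1 ≤ m)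
    (q : Fin m → ℝ) (hq : ∀ j, 1 < q j) (ν : X → ℝ≥0∞) (σ : Fin m → X → ℝ≥0∞)
    (hν : Measurable ν) (hσ : ∀ j, Measurable (σ j))
    (h1 : ∀ᵐ x ∂μ, 1 ≤ ν x ^ (∑ i, (q i)⁻¹) * ∏ j, σ j x ^ (1 - (q j)⁻¹)) (E Q : Set X)
    (hEQ : E ⊆ Q) (hv0 : μ Q ≠ 0) (hvt : μ Q ≠ ⊤) (hE : μ Q ≤ 2 * μ E) (K : ℝ≥0∞)
    (hK : (∫⁻ x in Q, ν x ∂μ) ^ (∑ i, (q i)⁻¹) *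
      ∏ j, (∫⁻ x in Q, σ j x ∂μ) ^ (1 - (q j)⁻¹) ≤ K * μ Q ^ m) (j : Fin m) :
    ∫⁻ x in Q, σ j x ∂μ ≤ (2 ^ m * K) ^ (1 - (q j)⁻¹)⁻¹ * ∫⁻ x in E, σ j x ∂μ := by
  have hqi : ∀ j, 0 < 1 - (q j)⁻¹ := fun j => by
    have := inv_lt_one_of_one_lt₀ (hq j); linarith
  have hP : 0 ≤ ∑ i, (q i)⁻¹ := Finset.sum_nonneg fun i _ => by
    have := hq i; positivity
  have H := holder_E μ hm q hq ν σ hν hσ h1 E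
  have hmain : μ Q ^ m * (∫⁻ x in Q, σ j x ∂μ) ^ (1 - (q j)⁻¹) ≤
      μ Q ^ m * (2 ^ m * K * (∫⁻ x in E, σ j x ∂μ) ^ (1 - (q j)⁻¹)) := by
    calc μ Q ^ m * (∫⁻ x in Q, σ j x ∂μ) ^ (1 - (q j)⁻¹)
        ≤ (2 * μ E) ^ m * (∫⁻ x in Q, σ j x ∂μ) ^ (1 - (q j)⁻¹) := by gcongr
      _ = 2 ^ m * μ E ^ m * (∫⁻ x in Q, σ j x ∂μ) ^ (1 - (q j)⁻¹) := by rw [mul_pow]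
      _ ≤ 2 ^ m * ((∫⁻ x in E, ν x ∂μ) ^ (∑ i, (q i)⁻¹) *
            ∏ j, (∫⁻ x in E, σ j x ∂μ) ^ (1 - (q j)⁻¹)) * (∫⁻ x in Q, σ j x ∂μ) ^ (1 - (q j)⁻¹) := by
          gcongr
      _ ≤ 2 ^ m * ((∫⁻ x in Q, ν x ∂μ) ^ (∑ i, (q i)⁻¹) *
            ((∫⁻ x in E, σ j x ∂μ) ^ (1 - (q j)⁻¹) *
              ∏ i ∈ Finset.univ.erase j, (∫⁻ x in Q, σ i x ∂μ) ^ (1 - (q i)⁻¹))) *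
                (∫⁻ x in Q, σ j x ∂μ) ^ (1 - (q j)⁻¹) := by
          rw [← Finset.mul_prod_erase Finset.univ _ (Finset.mem_univ j)]
          gcongr with i
          linarith [hqi ‹_›]
      _ = 2 ^ m * ((∫⁻ x in Q, ν x ∂μ) ^ (∑ i, (q i)⁻¹) *
            ∏ i, (∫⁻ x in Q, σ i x ∂μ) ^ (1 - (q i)⁻¹)) * (∫⁻ x in E, σ j x ∂μ) ^ (1 - (q j)⁻¹) := by
          rw [← Finset.mul_prod_erase Finset.univ (fun i => (∫⁻ x in Q, σ i x ∂μ) ^ (1 - (q i)⁻¹)) (Finset.mem_univ j)]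
          ring
      _ ≤ 2 ^ m * (K * μ Q ^ m) * (∫⁻ x in E, σ j x ∂μ) ^ (1 - (q j)⁻¹) := by gcongr
      _ = _ := by ring
  have h2 := (ENNReal.mul_le_mul_iff_right (pow_ne_zero m hv0) (ENNReal.pow_ne_top hvt)).1 hmain
  have h3 := ENNReal.rpow_le_rpow h2 (inv_nonneg.2 (hqi j).le)
  rwa [ENNReal.rpow_rpow_inv (hqi j).ne', ENNReal.mul_rpow_of_nonneg _ _ (inv_nonneg.2 (hqi j).le),
    ENNReal.rpow_rpow_inv (hqi j).ne'] at h3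

lemma summand {m : ℕ} (hm : 1 ≤ m) (q : Fin m → ℝ) (hq : ∀ j, 1 < q j) (V N K : ℝ≥0∞)
    (s c : Fin m → ℝ≥0∞) (hV0 : V ≠ 0) (hVt : V ≠ ⊤) 
    (hK : N ^ (∑ i, (q i)⁻¹) * ∏ j, s j ^ (1 - (q j)⁻¹) ≤ K * V ^ m) :
    (∏ j, V⁻¹ * (c j * s j)) ^ (∑ i, (q i)⁻¹)⁻¹ * N ≤
      K ^ (∑ i, (q i)⁻¹)⁻¹ * ∏ j, (c j ^ q j * s j) ^ ((∑ i, (q i)⁻¹)⁻¹ / q j) := by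
  have hqi : ∀ j, 0 < 1 - (q j)⁻¹ := fun j => by
    have := inv_lt_one_of_one_lt₀ (hq j); linarith
  have hq0 : ∀ j, 0 < q j := fun j => by linarith [hq j]
  have hP : 0 < ∑ i, (q i)⁻¹ := by
    have : Nonempty (Fin m) := ⟨⟨0, hm⟩⟩
    exact Finset.sum_pos (fun i _ => inv_pos.2 (hq0 i)) Finset.univ_nonempty
  set P := ∑ i, (q i)⁻¹ with hPd
  have key : (∏ j, V⁻¹ * (c j * s j)) * N ^ P ≤ K * ∏ j, (c j * s j ^ (q j)⁻¹) := by
    have e1 : ∀ j, s j = s j ^ (1 - (q j)⁻¹) * s j ^ (q j)⁻¹ := fun j => by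
      rw [← ENNReal.rpow_add_of_nonneg _ _ (hqi j).le (inv_nonneg.2 (hq0 j).le)]
      simp
    calc (∏ j, V⁻¹ * (c j * s j)) * N ^ P
        = (∏ j, V⁻¹ * (c j * (s j ^ (1 - (q j)⁻¹) * s j ^ (q j)⁻¹))) * N ^ P := by
          congr 1
          exact Finset.prod_congr rfl fun j _ => by rw [← e1 j]
      _ = (V⁻¹) ^ m * (N ^ P * ∏ j, s j ^ (1 - (q j)⁻¹)) * ∏ j, (c j * s j ^ (q j)⁻¹) := by
          simp only [Finset.prod_mul_distrib, Finset.prod_const, Finset.card_univ, Fintype.card_fin]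
          ring
      _ ≤ (V⁻¹) ^ m * (K * V ^ m) * ∏ j, (c j * s j ^ (q j)⁻¹) := by gcongr
      _ = (V⁻¹ * V) ^ m * K * ∏ j, (c j * s j ^ (q j)⁻¹) := by rw [mul_pow]; ring
      _ = _ := by rw [ENNReal.inv_mul_cancel hV0 hVt, one_pow, one_mul]
  have h3 := ENNReal.rpow_le_rpow key (inv_nonneg.2 hP.le)
  rw [ENNReal.mul_rpow_of_nonneg _ _ (inv_nonneg.2 hP.le), ENNReal.rpow_rpow_inv hP.ne',
    ENNReal.mul_rpow_of_nonneg _ _ (inv_nonneg.2 hP.le),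
    ← ENNReal.prod_rpow_of_nonneg (f := fun j => c j * s j ^ (q j)⁻¹) (inv_nonneg.2 hP.le)] at h3
  refine h3.trans (le_of_eq ?_)
  congr 1
  refine Finset.prod_congr rfl fun j _ => ?_
  rw [div_eq_inv_mul, ENNReal.rpow_mul]
  congr 1
  rw [ENNReal.mul_rpow_of_nonneg _ _ (inv_nonneg.2 (hq0 j).le), ENNReal.rpow_rpow_inv (hq0 j).ne']

def cGrid {m : ℕ} (q : Fin m → ℝ) (K : ℝ≥0∞) : ℝ≥0∞ :=
  (2 ^ m) ^ (∑ i, (q i)⁻¹)⁻¹ * (K ^ (∑ i, (q i)⁻¹)⁻¹ *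
    ∏ j, ((2 ^ m * K) ^ (1 - (q j)⁻¹)⁻¹ * (2 * cMax (q j))) ^ ((∑ i, (q i)⁻¹)⁻¹ / q j))

theorem grid_main {X ι : Type*} [MeasurableSpace X] [Countable ι] {Q : ι → Set X} {lev : ι → ℕ}
    (hG : IsGrid Q lev) (μ : Measure X) {m : ℕ} (hm : 1 ≤ m)
    (q : Fin m → ℝ) (hq : ∀ j, 1 < q j) (ν : X → ℝ≥0∞) (σ f g : Fin m → X → ℝ≥0∞)
    (hν : Measurable ν) (hσ : ∀ j, Measurable (σ j)) (hg : ∀ j, Measurable (g j))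
    (hgt : ∀ j x, g j x ≠ ⊤)
    (hfg : ∀ j, ∀ᵐ x ∂μ, f j x = σ j x * g j x)
    (h1 : ∀ᵐ x ∂μ, 1 ≤ ν x ^ (∑ i, (q i)⁻¹) * ∏ j, σ j x ^ (1 - (q j)⁻¹))
    (hv0 : ∀ a, μ (Q a) ≠ 0) (hvt : ∀ a, μ (Q a) ≠ ⊤)
    (hs0 : ∀ a j, ∫⁻ x in Q a, σ j x ∂μ ≠ 0) (hst : ∀ a j, ∫⁻ x in Q a, σ j x ∂μ ≠ ⊤)
    (hfin : ∀ a j, ∫⁻ y in Q a, f j y ∂μ ≠ ⊤) (K : ℝ≥0∞)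
    (hK : ∀ a, (∫⁻ x in Q a, ν x ∂μ) ^ (∑ i, (q i)⁻¹) *
      ∏ j, (∫⁻ x in Q a, σ j x ∂μ) ^ (1 - (q j)⁻¹) ≤ K * μ (Q a) ^ m) :
    ∫⁻ x, (⨆ (a : ι) (_ : x ∈ Q a), gAvg Q μ f a) ^ (∑ i, (q i)⁻¹)⁻¹ * ν x ∂μ ≤
      cGrid q K * ∏ j, (∫⁻ x, σ j x * g j x ^ q j ∂μ) ^ ((∑ i, (q i)⁻¹)⁻¹ / q j) := by
  have hqi : ∀ j, 0 < 1 - (q j)⁻¹ := fun j => by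
    have := inv_lt_one_of_one_lt₀ (hq j); linarith
  have hq0 : ∀ j, 0 < q j := fun j => by linarith [hq j]
  have hP : 0 < ∑ i, (q i)⁻¹ := by
    have : Nonempty (Fin m) := ⟨⟨0, hm⟩⟩
    exact Finset.sum_pos (fun i _ => inv_pos.2 (hq0 i)) Finset.univ_nonempty
  set P := ∑ i, (q i)⁻¹ with hPd
  have hp : 0 < P⁻¹ := inv_pos.2 hP
  have hat : ∀ a, gAvg Q μ f a ≠ ⊤ := fun a =>
    ENNReal.prod_ne_top fun j _ => ENNReal.mul_ne_top (by simp [hv0]) (hfin a j)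
  obtain ⟨S, k, hS0, hSd, hSc⟩ := records hG μ hm f hv0 hat
  set s : Fin m → ι → ℝ≥0∞ := fun j a => ∫⁻ x in Q a, σ j x ∂μ with hs
  set ρ : Fin m → Measure X := fun j => μ.withDensity (σ j) with hρ
  have hρQ : ∀ j a, ρ j (Q a) = s j a := fun j a => withDensity_apply _ (hG.meas a)
  have hρE : ∀ j a, ρ j (gE Q μ f a) = ∫⁻ x in gE Q μ f a, σ j x ∂μ := fun j a =>
    withDensity_apply _ (gE_meas hG μ f a)
  set c : Fin m → ι → ℝ≥0∞ := fun j a => (ρ j (Q a))⁻¹ * ∫⁻ y in Q a, g j y ∂(ρ j) with hc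
  have hcs : ∀ j a, ∫⁻ y in Q a, f j y ∂μ = c j a * s j a := by
    intro j a
    have e : ∫⁻ y in Q a, g j y ∂(ρ j) = ∫⁻ y in Q a, f j y ∂μ := by
      rw [hρ, setLIntegral_withDensity_eq_setLIntegral_mul μ (hσ j) (hg j) (hG.meas a)]
      refine lintegral_congr_ae (ae_restrict_of_ae ?_)
      filter_upwards [hfg j] with x hx
      simp [hx]
    simp only [hc]
    rw [e, hρQ, mul_right_comm, ENNReal.inv_mul_cancel (hs0 a j) (hst a j), one_mul]
  -- pointwise
  have hpt : ∀ x, (⨆ (a : ι) (_ : x ∈ Q a), gAvg Q μ f a) ^ P⁻¹ ≤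
      (2 ^ m) ^ P⁻¹ * ∑' b : S, (Q b).indicator (fun _ => gAvg Q μ f b ^ P⁻¹) x := by
    intro x
    have e : (⨆ (a : ι) (_ : x ∈ Q a), gAvg Q μ f a) ^ P⁻¹ =
        ⨆ (a : ι) (_ : x ∈ Q a), gAvg Q μ f a ^ P⁻¹ := by
      have := (ENNReal.orderIsoRpow P⁻¹ hp).map_iSup₂ (fun a (_ : x ∈ Q a) => gAvg Q μ f a)
      exact this
    rw [e]
    refine iSup₂_le fun a ha => ?_
    by_cases h0 : gAvg Q μ f a = 0
    · rw [h0, ENNReal.zero_rpow_of_pos hp]; exact zero_le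
    obtain ⟨b, hb, hxb, hle⟩ := hSc a x ha h0
    calc gAvg Q μ f a ^ P⁻¹ ≤ (2 ^ m * gAvg Q μ f b) ^ P⁻¹ := by gcongr
      _ = (2 ^ m) ^ P⁻¹ * gAvg Q μ f b ^ P⁻¹ := ENNReal.mul_rpow_of_nonneg _ _ hp.le
      _ ≤ _ := by
        gcongr
        have := ENNReal.le_tsum (f := fun b : S => (Q b).indicator (fun _ => gAvg Q μ f b ^ P⁻¹) x) ⟨b, hb⟩
        refine le_trans ?_ this
        simp only
        rw [indicator_of_mem hxb]
  have hsum : ∫⁻ x, (⨆ (a : ι) (_ : x ∈ Q a), gAvg Q μ f a) ^ P⁻¹ * ν x ∂μ ≤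
      (2 ^ m) ^ P⁻¹ * ∑' b : S, gAvg Q μ f b ^ P⁻¹ * ∫⁻ x in Q b, ν x ∂μ := by
    calc _ ≤ ∫⁻ x, (2 ^ m) ^ P⁻¹ * ∑' b : S, (Q b).indicator (fun y => gAvg Q μ f b ^ P⁻¹ * ν y) x ∂μ := by
          refine lintegral_mono fun x => ?_
          refine (mul_le_mul_left (hpt x) (ν x)).trans (le_of_eq ?_)
          rw [mul_assoc, ← ENNReal.tsum_mul_right]
          congr 1
          refine tsum_congr fun b => ?_
          by_cases hx : x ∈ Q b <;> simp [hx]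
      _ = _ := by
          rw [lintegral_const_mul' _ _ (by
            refine ENNReal.rpow_ne_top_of_nonneg hp.le (by simp)), lintegral_tsum]
          · congr 1
            refine tsum_congr fun b => ?_
            rw [lintegral_indicator (hG.meas b), lintegral_const_mul _ hν]
          · intro b
            exact ((hν.const_mul _).indicator (hG.meas b)).aemeasurable
  have hsm : ∀ b, gAvg Q μ f b ^ P⁻¹ * ∫⁻ x in Q b, ν x ∂μ ≤
      K ^ P⁻¹ * ∏ j, (c j b ^ q j * s j b) ^ (P⁻¹ / q j) := by
    intro b
    have := summand hm q hq (μ (Q b)) (∫⁻ x in Q b, ν x ∂μ) K (fun j => s j b) (fun j => c j b)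
      (hv0 b) (hvt b) (hK b)
    refine le_trans (le_of_eq ?_) this
    simp only [gAvg, hcs]
    rfl
  have hj : ∀ j, ∑' b : S, c j b ^ q j * s j b ≤
      (2 ^ m * K) ^ (1 - (q j)⁻¹)⁻¹ * (2 * cMax (q j)) * ∫⁻ x, σ j x * g j x ^ q j ∂μ := by
    intro j
    set D := (2 ^ m * K) ^ (1 - (q j)⁻¹)⁻¹
    calc ∑' b : S, c j b ^ q j * s j b
        ≤ ∑' b : S, D * ∫⁻ x in gE Q μ f b, gMax Q (ρ j) (g j) x ^ q j ∂(ρ j) := by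
          refine ENNReal.tsum_le_tsum fun b => ?_
          have hE := gE_large hG μ hm f hv0 hvt hfin b (hS0 b b.2)
          have h2 := sigma_E μ hm q hq ν σ hν hσ h1 (gE Q μ f b) (Q b) sdiff_subset (hv0 b) (hvt b)
            hE K (hK b) j
          rw [← hρE] at h2
          have h3 : c j b ^ q j * ρ j (gE Q μ f b) ≤
              ∫⁻ x in gE Q μ f b, gMax Q (ρ j) (g j) x ^ q j ∂(ρ j) := by
            rw [← setLIntegral_const]
            refine setLIntegral_mono' (gE_meas hG μ f b) fun x hx => ?_
            refine ENNReal.rpow_le_rpow ?_ (hq0 j).le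
            exact le_iSup₂_of_le (f := fun (a : ι) (_ : x ∈ Q a) =>
              (ρ j (Q a))⁻¹ * ∫⁻ y in Q a, g j y ∂(ρ j)) (b : ι) hx.1 le_rfl
          calc c j b ^ q j * s j b ≤ c j b ^ q j * (D * ρ j (gE Q μ f b)) := by gcongr
            _ = D * (c j b ^ q j * ρ j (gE Q μ f b)) := by ring
            _ ≤ _ := by gcongr
      _ ≤ D * (2 * ∫⁻ x, gMax Q (ρ j) (g j) x ^ q j ∂(ρ j)) := by
          rw [ENNReal.tsum_mul_left]
          gcongr
          exact sum_parity (ρ j) _ (gE_meas hG μ f) S k hSd _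
      _ ≤ D * (2 * (cMax (q j) * ∫⁻ x, g j x ^ q j ∂(ρ j))) := by
          gcongr
          exact gMax_strong hG (ρ j) (g j) (hg j) (hgt j) (q j) (hq j)
      _ = _ := by
          rw [hρ, lintegral_withDensity_eq_lintegral_mul _ (hσ j) ((hg j).pow_const _)]
          simp only [Pi.mul_apply]
          ring
  have hsum1 : ∑ j, P⁻¹ / q j = 1 := by
    simp only [div_eq_mul_inv]
    rw [← Finset.mul_sum, ← hPd, inv_mul_cancel₀ hP.ne']
  have hpq : ∀ j, 0 ≤ P⁻¹ / q j := fun j => div_nonneg hp.le (hq0 j).le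
  refine hsum.trans ?_
  rw [cGrid, ← hPd, mul_assoc, mul_assoc, ← Finset.prod_mul_distrib]
  gcongr
  calc ∑' b : S, gAvg Q μ f b ^ P⁻¹ * ∫⁻ x in Q b, ν x ∂μ
      ≤ ∑' b : S, K ^ P⁻¹ * ∏ j, (c j b ^ q j * s j b) ^ (P⁻¹ / q j) :=
        ENNReal.tsum_le_tsum fun b => hsm b
    _ = K ^ P⁻¹ * ∑' b : S, ∏ j, (c j b ^ q j * s j b) ^ (P⁻¹ / q j) := ENNReal.tsum_mul_left
    _ ≤ K ^ P⁻¹ * ∏ j, (∑' b : S, c j b ^ q j * s j b) ^ (P⁻¹ / q j) := by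
        gcongr
        exact holder_tsum (fun j (b : S) => c j b ^ q j * s j b) _ hsum1 hpq
    _ ≤ _ := by
        gcongr with j
        rw [← ENNReal.mul_rpow_of_nonneg _ _ (hpq j)]
        exact ENNReal.rpow_le_rpow (hj j) (hpq j)

/-- side length -/
def gSide (N i : ℕ) : ℝ := 2 ^ N / 2 ^ i

lemma gSide_pos (N i : ℕ) : 0 < gSide N i := by unfold gSide; positivity

lemma gSide_le (N i : ℕ) : gSide N i ≤ 2 ^ N := by
  unfold gSide
  exact div_le_self (by positivity) (one_le_pow₀ (by norm_num))

/-- shift vector coordinate -/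
def gShift {n : ℕ} (N : ℕ) (e : Fin n → Bool) (l : Fin n) : ℝ := if e l then 2 ^ N / 3 else 0

def gQ (n N : ℕ) (e : Fin n → Bool) (a : ℕ × (Fin n → ℤ)) : Set (En n) :=
  {y | ∀ l, ⌊(y l - gShift N e l) / gSide N a.1⌋ = a.2 l}

lemma vol_box {n : ℕ} (A B : Fin n → ℝ) :
    volume {y : En n | ∀ l, A l ≤ y l ∧ y l < B l} = ∏ l, ENNReal.ofReal (B l - A l) := by
  have h := (PiLp.volume_preserving_ofLp (Fin n)).measure_preimage
    (s := Set.pi univ fun l => Ico (A l) (B l))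
    (MeasurableSet.univ_pi fun l => measurableSet_Ico).nullMeasurableSet
  rw [Real.volume_pi_Ico] at h
  rw [← h]
  congr 1
  ext y
  simp [Set.mem_pi]

lemma vol_cube {n : ℕ} (x : En n) {r : ℝ} (hr : 0 < r) :
    volume (cube x r) = ENNReal.ofReal r ^ n := by
  have h := (PiLp.volume_preserving_ofLp (Fin n)).measure_preimage
    (s := Set.pi univ fun l => Icc (x l - r/2) (x l + r/2))
    (MeasurableSet.univ_pi fun l => measurableSet_Icc).nullMeasurableSet
  rw [Set.pi_univ_Icc, Real.volume_Icc_pi] at h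
  have h2 : ∏ i : Fin n, ENNReal.ofReal (x i + r/2 - (x i - r/2)) = ENNReal.ofReal r ^ n := by
    calc _ = ∏ _i : Fin n, ENNReal.ofReal r :=
          Finset.prod_congr rfl fun l _ => by congr 1; ring
      _ = _ := by simp
  rw [← h2, ← h]
  congr 1
  ext y
  simp only [cube, mem_ofPred_eq, mem_preimage, Set.mem_Icc, Pi.le_def, abs_le]
  constructor
  · intro hy
    exact ⟨fun i => by have := (hy i).1; linarith, fun i => by have := (hy i).2; linarith⟩
  · intro hy i
    have h1 := hy.1 i; have h2 := hy.2 i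
    constructor <;> linarith

lemma cube_meas {n : ℕ} (x : En n) (r : ℝ) : MeasurableSet (cube x r) := by
  have : cube x r = ⋂ i, {y : En n | |y i - x i| ≤ r / 2} := by
    ext y; simp [cube]
  rw [this]
  exact MeasurableSet.iInter fun i => measurableSet_le (by fun_prop) (by fun_prop)

lemma gQ_eq (n N : ℕ) (e : Fin n → Bool) (a : ℕ × (Fin n → ℤ)) :
    gQ n N e a = {y : En n | ∀ l, gShift N e l + gSide N a.1 * a.2 l ≤ y l ∧
      y l < gShift N e l + gSide N a.1 * (a.2 l + 1)} := by
  ext y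
  simp only [gQ, mem_ofPred_eq]
  refine forall_congr' fun l => ?_
  have := gSide_pos N a.1
  rw [Int.floor_eq_iff, le_div_iff₀ this, div_lt_iff₀ this]
  constructor <;> rintro ⟨h1, h2⟩ <;> constructor <;> linarith

lemma gQ_vol (n N : ℕ) (e : Fin n → Bool) (a : ℕ × (Fin n → ℤ)) :
    volume (gQ n N e a) = ENNReal.ofReal (gSide N a.1) ^ n := by
  rw [gQ_eq, vol_box]
  calc _ = ∏ _i : Fin n, ENNReal.ofReal (gSide N a.1) :=
        Finset.prod_congr rfl fun l _ => by congr 1; ring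
    _ = _ := by simp

lemma gQ_grid (n N : ℕ) (e : Fin n → Bool) : IsGrid (gQ n N e) Prod.fst where
  meas a := by
    have : gQ n N e a = ⋂ l, {y : En n | ⌊(y l - gShift N e l) / gSide N a.1⌋ = a.2 l} := by
      ext y; simp [gQ]
    rw [this]
    refine MeasurableSet.iInter fun l => ?_
    have hm : Measurable fun y : En n => ⌊(y l - gShift N e l) / gSide N a.1⌋ :=
      Int.measurable_floor.comp (by fun_prop)
    exact hm (measurableSet_singleton (a.2 l))
  nested a b hab := by
    by_cases hd : Disjoint (gQ n N e a) (gQ n N e b)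
    · exact Or.inr hd
    left
    rw [Set.not_disjoint_iff] at hd
    obtain ⟨z, hza, hzb⟩ := hd
    have key : ∀ y : En n, ∀ l, ⌊(y l - gShift N e l) / gSide N a.1⌋ =
        ⌊(y l - gShift N e l) / gSide N b.1⌋ / ((2 ^ (b.1 - a.1) : ℕ) : ℤ) := by
      intro y l
      rw [← Int.floor_div_natCast]
      congr 1
      unfold gSide
      have : (2:ℝ) ^ b.1 = 2 ^ a.1 * 2 ^ (b.1 - a.1) := by
        rw [← pow_add]; congr 1; omega
      rw [this]; push_cast
      field_simp
    intro y hy l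
    have hy' : ∀ l, _ := hy
    have hza' : ∀ l, _ := hza
    have hzb' : ∀ l, _ := hzb
    rw [key y l, hy' l, ← hzb' l, ← key z l, hza' l]
  same a b hab hne := by
    rw [Set.disjoint_left]
    intro y hya hyb
    apply hne
    have hya' : ∀ l, _ := hya
    have hyb' : ∀ l, _ := hyb
    refine Prod.ext hab (funext fun l => ?_)
    rw [← hya' l, ← hyb' l, hab]

lemma gQ_sub_cube (n N : ℕ) (e : Fin n → Bool) (a : ℕ × (Fin n → ℤ)) :
    ∃ x : En n, gQ n N e a ⊆ cube x (gSide N a.1) := by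
  refine ⟨WithLp.toLp 2 fun l => gShift N e l + gSide N a.1 * (a.2 l + 1/2), ?_⟩
  rw [gQ_eq]
  intro y hy l
  have h : ∀ l, _ := hy
  have := h l
  rw [abs_le]
  constructor <;> simp only [] <;> linarith [this.1, this.2]

lemma floor_third (i : ℕ) (u w : ℝ) (h1 : u ≤ w) (h2 : w ≤ u + 1/3) :
    ⌊u⌋ = ⌊w⌋ ∨ ⌊u - 2^i/3⌋ = ⌊w - 2^i/3⌋ := by
  by_contra hc
  push Not at hc
  obtain ⟨ha, hb⟩ := hc
  have ha' : ⌊u⌋ < ⌊w⌋ := lt_of_le_of_ne (Int.floor_le_floor h1) ha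
  have hb' : ⌊u - 2^i/3⌋ < ⌊w - 2^i/3⌋ := lt_of_le_of_ne (Int.floor_le_floor (by linarith)) hb
  have a1 := Int.floor_lt.1 ha'
  have b1 := Int.floor_lt.1 hb'
  have a2 := Int.floor_le w
  have b2 := Int.floor_le (w - 2^i/3)
  set k := ⌊w⌋
  set k' := ⌊w - 2^i/3⌋
  have c1 : (3 * (k - k') - 2 ^ i : ℝ) < 1 := by linarith
  have c2 : (-1:ℝ) < (3 * (k - k') - 2 ^ i : ℝ) := by linarith
  have d1 : 3 * (k - k') - 2 ^ i < 1 := by exact_mod_cast c1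
  have d2 : -1 < 3 * (k - k') - 2 ^ i := by exact_mod_cast c2
  have d3 : (2:ℤ) ^ i = 3 * (k - k') := by omega
  have d4 : (3:ℤ) ∣ 2 ^ i := ⟨_, d3⟩
  have := Int.prime_three.dvd_of_dvd_pow d4
  omega

lemma cube_sub_gQ {n : ℕ} (N : ℕ) (c : En n) (r : ℝ) (hr : 0 < r) (hN : 3 * r ≤ 2 ^ N) :
    ∃ (e : Fin n → Bool) (a : ℕ × (Fin n → ℤ)), cube c r ⊆ gQ n N e a ∧
      gSide N a.1 ≤ 6 * r := by
  obtain ⟨i, hi1, hi2⟩ := exists_nat_pow_near (x := (2:ℝ)^N / (3 * r)) (y := 2)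
    (by rw [le_div_iff₀ (by positivity)]; linarith) (by norm_num)
  have hs := gSide_pos N i
  have s1 : 3 * r ≤ gSide N i := by
    unfold gSide
    rw [le_div_iff₀ (by positivity)] at hi1 ⊢
    linarith
  have s2 : gSide N i ≤ 6 * r := by
    unfold gSide
    rw [div_lt_iff₀ (by positivity), pow_succ] at hi2
    rw [div_le_iff₀ (by positivity)]
    linarith
  have key : ∀ l, ∃ b : Bool,
      ⌊(c l - r/2 - (if b then 2^N/3 else 0)) / gSide N i⌋ =
      ⌊(c l + r/2 - (if b then 2^N/3 else 0)) / gSide N i⌋ := by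
    intro l
    have h := floor_third i ((c l - r/2) / gSide N i) ((c l + r/2) / gSide N i)
      ((div_le_div_iff_of_pos_right hs).2 (by linarith)) (by
        rw [div_add' _ _ _ hs.ne']; exact (div_le_div_iff_of_pos_right hs).2 (by linarith))
    have ht : (2:ℝ)^i/3 = 2^N/3 / gSide N i := by
      unfold gSide; field_simp
    rcases h with h | h
    · exact ⟨false, by simpa using h⟩
    · refine ⟨true, ?_⟩
      rw [ht, ← sub_div, ← sub_div] at h
      simpa using h
  choose e he using key
  refine ⟨e, (i, fun l => ⌊(c l - r/2 - gShift N e l) / gSide N i⌋), ?_, s2⟩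
  intro y hy l
  have hy' : ∀ l, _ := hy
  have h1 := abs_le.1 (hy' l)
  have h2 := he l
  apply le_antisymm
  · have : ⌊(c l - r/2 - gShift N e l) / gSide N i⌋ = ⌊(c l + r/2 - gShift N e l) / gSide N i⌋ := h2
    simp only
    rw [this]
    apply Int.floor_le_floor
    gcongr; linarith [h1.2]
  · apply Int.floor_le_floor
    simp only
    gcongr; linarith [h1.1]

def gGam {m : ℕ} (q : Fin m → ℝ) : ℝ :=
  (∑ i, (q i)⁻¹)⁻¹ + ∑ j, (1 - (q j)⁻¹)⁻¹ * ((∑ i, (q i)⁻¹)⁻¹ / q j)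

lemma gGam_pos {m : ℕ} (hm : 1 ≤ m) (q : Fin m → ℝ) (hq : ∀ j, 1 < q j) :
    0 < (∑ i, (q i)⁻¹) ∧ 0 < gGam q := by
  have hqi : ∀ j, 0 < 1 - (q j)⁻¹ := fun j => by
    have := inv_lt_one_of_one_lt₀ (hq j); linarith
  have hq0 : ∀ j, 0 < q j := fun j => by linarith [hq j]
  have hP : 0 < ∑ i, (q i)⁻¹ := by
    have : Nonempty (Fin m) := ⟨⟨0, hm⟩⟩
    exact Finset.sum_pos (fun i _ => inv_pos.2 (hq0 i)) Finset.univ_nonempty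
  refine ⟨hP, add_pos_of_pos_of_nonneg (inv_pos.2 hP) (Finset.sum_nonneg fun j _ => ?_)⟩
  exact mul_nonneg (inv_nonneg.2 (hqi j).le) (div_nonneg (inv_pos.2 hP).le (hq0 j).le)

lemma prod_rpow_exp {ι : Type*} (s : Finset ι) (t : ℝ≥0∞) (a : ι → ℝ) (ha : ∀ i ∈ s, 0 ≤ a i) :
    ∏ i ∈ s, t ^ a i = t ^ ∑ i ∈ s, a i := by
  classical
  induction s using Finset.induction_on with
  | empty => simp
  | insert i s his ih =>
    rw [Finset.prod_insert his, Finset.sum_insert his, ih fun j hj => ha j (by simp [hj]),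
      ENNReal.rpow_add_of_nonneg _ _ (ha i (by simp))
        (Finset.sum_nonneg fun j hj => ha j (by simp [hj]))]

lemma cGrid_mul {m : ℕ} (hm : 1 ≤ m) (q : Fin m → ℝ) (hq : ∀ j, 1 < q j) (K t : ℝ≥0∞) :
    cGrid q (K * t) = cGrid q K * t ^ gGam q := by
  have hqi : ∀ j, 0 < 1 - (q j)⁻¹ := fun j => by
    have := inv_lt_one_of_one_lt₀ (hq j); linarith
  have hq0 : ∀ j, 0 < q j := fun j => by linarith [hq j]
  have hP := (gGam_pos hm q hq).1
  unfold cGrid gGam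
  set P := ∑ i, (q i)⁻¹ with hPd
  have hnn : ∀ j, 0 ≤ (1 - (q j)⁻¹)⁻¹ * (P⁻¹ / q j) := fun j =>
    mul_nonneg (inv_nonneg.2 (hqi j).le) (div_nonneg (inv_pos.2 hP).le (hq0 j).le)
  have e : ∀ j, ((2 ^ m * (K * t)) ^ (1 - (q j)⁻¹)⁻¹ * (2 * cMax (q j))) ^ (P⁻¹ / q j) =
      ((2 ^ m * K) ^ (1 - (q j)⁻¹)⁻¹ * (2 * cMax (q j))) ^ (P⁻¹ / q j) *
        t ^ ((1 - (q j)⁻¹)⁻¹ * (P⁻¹ / q j)) := by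
    intro j
    have h1 : 0 ≤ P⁻¹ / q j := div_nonneg (inv_pos.2 hP).le (hq0 j).le
    rw [← mul_assoc (2 ^ m) K t, ENNReal.mul_rpow_of_nonneg _ t (inv_nonneg.2 (hqi j).le),
      ENNReal.rpow_mul, ← ENNReal.mul_rpow_of_nonneg _ _ h1]
    congr 1; ring
  rw [Finset.prod_congr rfl fun j _ => e j, Finset.prod_mul_distrib,
    prod_rpow_exp _ _ _ (fun j _ => hnn j),
    ENNReal.rpow_add_of_nonneg _ _ (inv_pos.2 hP).le (Finset.sum_nonneg fun j _ => hnn j),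
    ENNReal.mul_rpow_of_nonneg _ _ (inv_pos.2 hP).le]
  ring

lemma cGrid_ne_top {m : ℕ} (hm : 1 ≤ m) (q : Fin m → ℝ) (hq : ∀ j, 1 < q j) {K : ℝ≥0∞}
    (hK : K ≠ ⊤) : cGrid q K ≠ ⊤ := by
  have hqi : ∀ j, 0 < 1 - (q j)⁻¹ := fun j => by
    have := inv_lt_one_of_one_lt₀ (hq j); linarith
  have hq0 : ∀ j, 0 < q j := fun j => by linarith [hq j]
  have hP := (gGam_pos hm q hq).1
  have h2 : (2:ℝ≥0∞) ^ m ≠ ⊤ := ENNReal.pow_ne_top (by simp)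
  unfold cGrid
  refine ENNReal.mul_ne_top (ENNReal.rpow_ne_top_of_nonneg (inv_pos.2 hP).le h2)
    (ENNReal.mul_ne_top (ENNReal.rpow_ne_top_of_nonneg (inv_pos.2 hP).le hK)
    (ENNReal.prod_ne_top fun j _ => ?_))
  refine ENNReal.rpow_ne_top_of_nonneg (div_nonneg (inv_pos.2 hP).le (hq0 j).le) ?_
  refine ENNReal.mul_ne_top (ENNReal.rpow_ne_top_of_nonneg (inv_nonneg.2 (hqi j).le)
    (ENNReal.mul_ne_top h2 hK)) (ENNReal.mul_ne_top (by simp) ?_)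
  unfold cMax
  exact ENNReal.ofReal_ne_top

lemma choose_N {r : ℝ} (hr : 0 < r) : ∃ N : ℕ, 3 * r ≤ 2 ^ N ∧ (2:ℝ) ^ N ≤ 6 * (1 + r) := by
  by_cases h : 3 * r ≤ 1
  · exact ⟨0, by simpa using h, by norm_num; linarith⟩
  · push Not at h
    obtain ⟨k, h1, h2⟩ := exists_nat_pow_near (x := 3 * r) (y := 2) h.le (by norm_num)
    refine ⟨k + 1, h2.le, ?_⟩
    rw [pow_succ]; linarith

def gD (n N : ℕ) (η : ℝ) : ℝ := (6 / 2 ^ N) ^ η * 6 ^ n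

lemma gD_ineq (n N : ℕ) {η r s : ℝ} (hη : 0 ≤ η) (hr : 0 < r) (hs : 0 < s) (hsr : s ≤ 6 * r)
    (hN : (2:ℝ) ^ N ≤ 6 * (1 + r)) :
    (ENNReal.ofReal ((1 + r) ^ η) * ENNReal.ofReal r ^ n)⁻¹ ≤
      ENNReal.ofReal (gD n N η) * (ENNReal.ofReal s ^ n)⁻¹ := by
  have h1 : 0 < (1 + r) ^ η := Real.rpow_pos_of_pos (by linarith) _
  rw [← ENNReal.ofReal_pow hr.le, ← ENNReal.ofReal_pow hs.le, ← ENNReal.ofReal_mul h1.le,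
    ← ENNReal.ofReal_inv_of_pos (by positivity), ← ENNReal.ofReal_inv_of_pos (by positivity),
    ← ENNReal.ofReal_mul (by unfold gD; positivity)]
  apply ENNReal.ofReal_le_ofReal
  unfold gD
  rw [mul_inv, mul_assoc]
  have a1 : ((1 + r) ^ η)⁻¹ ≤ (6 / 2 ^ N) ^ η := by
    rw [← Real.inv_rpow (by linarith)]
    apply Real.rpow_le_rpow (by positivity) _ hη
    rw [inv_le_comm₀ (by linarith) (by positivity), inv_div, div_le_iff₀ (by norm_num)]
    linarith
  have a2 : (r ^ n)⁻¹ ≤ 6 ^ n * (s ^ n)⁻¹ := by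
    rw [← div_eq_mul_inv, ← div_pow, ← inv_pow]
    apply pow_le_pow_left₀ (by positivity)
    rw [inv_eq_one_div, div_le_div_iff₀ hr hs]
    linarith
  exact mul_le_mul a1 a2 (by positivity) (by positivity)

def gSup (n N : ℕ) (e : Fin n → Bool) {m : ℕ} (F : Fin m → En n → ℝ≥0∞) (x : En n) : ℝ≥0∞ :=
  ⨆ (a : ℕ × (Fin n → ℤ)) (_ : x ∈ gQ n N e a), gAvg (gQ n N e) volume F a

lemma gSup_meas (n N : ℕ) (e : Fin n → Bool) {m : ℕ} (F : Fin m → En n → ℝ≥0∞) :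
    Measurable (gSup n N e F) := by
  have : gSup n N e F = fun x => ⨆ a, (gQ n N e a).indicator
      (fun _ => gAvg (gQ n N e) volume F a) x := by
    funext x
    unfold gSup
    congr 1; funext a
    by_cases h : x ∈ gQ n N e a <;> simp [h]
  rw [this]
  exact Measurable.iSup fun a => measurable_const.indicator ((gQ_grid n N e).meas a)

lemma multiMax_le (n m : ℕ) {η p : ℝ} (hη : 0 ≤ η) (hp : 0 < p) (f : Fin m → En n → ℝ)
    (x : En n) :
    multiMax n m η f x ^ p ≤ ∑' N : ℕ, ∑ e : Fin n → Bool,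
      (ENNReal.ofReal (gD n N η) ^ m) ^ p *
        gSup n N e (fun j y => ENNReal.ofReal |f j y|) x ^ p := by
  set R := ∑' N : ℕ, ∑ e : Fin n → Bool,
      (ENNReal.ofReal (gD n N η) ^ m) ^ p *
        gSup n N e (fun j y => ENNReal.ofReal |f j y|) x ^ p with hR
  have hRr : R = (R ^ p⁻¹) ^ p := by rw [← ENNReal.rpow_mul, inv_mul_cancel₀ hp.ne']; simp
  rw [hRr]
  apply ENNReal.rpow_le_rpow _ hp.le
  unfold multiMax
  refine iSup_le fun c => iSup_le fun r => iSup_le fun hr => iSup_le fun hx => ?_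
  obtain ⟨N, hN1, hN2⟩ := choose_N hr
  obtain ⟨e, a, hsub, hs⟩ := cube_sub_gQ N c r hr hN1
  rw [ENNReal.le_rpow_inv_iff hp]
  have hb : (∏ j, (ENNReal.ofReal ((1 + r) ^ η) * volume (cube c r))⁻¹ *
      ∫⁻ y in cube c r, ENNReal.ofReal |f j y|) ≤
      ENNReal.ofReal (gD n N η) ^ m * gSup n N e (fun j y => ENNReal.ofReal |f j y|) x := by
    calc _ ≤ ∏ j : Fin m, ENNReal.ofReal (gD n N η) *
          ((volume (gQ n N e a))⁻¹ * ∫⁻ y in gQ n N e a, ENNReal.ofReal |f j y|) := by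
          refine Finset.prod_le_prod' fun j _ => ?_
          rw [← mul_assoc]
          refine mul_le_mul' ?_ (lintegral_mono_set hsub)
          rw [vol_cube c hr, gQ_vol]
          exact gD_ineq n N hη hr (gSide_pos _ _) hs hN2
      _ = ENNReal.ofReal (gD n N η) ^ m * gAvg (gQ n N e) volume
            (fun j y => ENNReal.ofReal |f j y|) a := by
          rw [Finset.prod_mul_distrib]; simp [gAvg]
      _ ≤ _ := by
          gcongr
          unfold gSup
          exact le_iSup₂_of_le a (hsub hx) le_rfl
  calc _ ≤ (ENNReal.ofReal (gD n N η) ^ m *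
        gSup n N e (fun j y => ENNReal.ofReal |f j y|) x) ^ p := ENNReal.rpow_le_rpow hb hp.le
    _ = (ENNReal.ofReal (gD n N η) ^ m) ^ p *
        gSup n N e (fun j y => ENNReal.ofReal |f j y|) x ^ p :=
        ENNReal.mul_rpow_of_nonneg _ _ hp.le
    _ ≤ ∑ e : Fin n → Bool, (ENNReal.ofReal (gD n N η) ^ m) ^ p *
        gSup n N e (fun j y => ENNReal.ofReal |f j y|) x ^ p :=
        Finset.single_le_sum (f := fun e : Fin n → Bool => (ENNReal.ofReal (gD n N η) ^ m) ^ p *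
        gSup n N e (fun j y => ENNReal.ofReal |f j y|) x ^ p) (fun _ _ => zero_le)
          (Finset.mem_univ e)
    _ ≤ R := ENNReal.le_tsum (f := fun N : ℕ => ∑ e : Fin n → Bool,
      (ENNReal.ofReal (gD n N η) ^ m) ^ p *
        gSup n N e (fun j y => ENNReal.ofReal |f j y|) x ^ p) N

def gTheta (m N : ℕ) (θ : ℝ) : ℝ≥0∞ := ENNReal.ofReal ((2 ^ (N + 1)) ^ θ) ^ m

def gTot (n m : ℕ) (q : Fin m → ℝ) (K : ℝ≥0∞) (θ η : ℝ) : ℝ≥0∞ :=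
  ∑' N : ℕ, ∑ _e : Fin n → Bool,
    (ENNReal.ofReal (gD n N η) ^ m) ^ (∑ i, (q i)⁻¹)⁻¹ * cGrid q (K * gTheta m N θ)

theorem full_main {n m : ℕ} (hm : 1 ≤ m) (q : Fin m → ℝ) (hq : ∀ j, 1 < q j)
    {θ η : ℝ} (hθ : 0 ≤ θ) (hη : 0 ≤ η)
    (f : Fin m → En n → ℝ) (ν : En n → ℝ≥0∞) (σ g : Fin m → En n → ℝ≥0∞)
    (hν : Measurable ν) (hσ : ∀ j, Measurable (σ j)) (hg : ∀ j, Measurable (g j))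
    (hgt : ∀ j x, g j x ≠ ⊤)
    (hfg : ∀ j, ∀ᵐ x, ENNReal.ofReal |f j x| = σ j x * g j x)
    (h1 : ∀ᵐ x, 1 ≤ ν x ^ (∑ i, (q i)⁻¹) * ∏ j, σ j x ^ (1 - (q j)⁻¹))
    (hs0 : ∀ j x, σ j x ≠ 0) (hst : ∀ x r, 0 < r → ∀ j, ∫⁻ y in cube x r, σ j y ≠ ⊤)
    (hfin : ∀ x r, 0 < r → ∀ j, ∫⁻ y in cube x r, ENNReal.ofReal |f j y| ≠ ⊤) (K : ℝ≥0∞)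
    (hK : ∀ x r, 0 < r → (∫⁻ y in cube x r, ν y) ^ (∑ i, (q i)⁻¹) *
      ∏ j, (∫⁻ y in cube x r, σ j y) ^ (1 - (q j)⁻¹) ≤
        K * (ENNReal.ofReal ((1 + r) ^ θ) * volume (cube x r)) ^ m) :
    ∫⁻ x, multiMax n m η f x ^ (∑ i, (q i)⁻¹)⁻¹ * ν x ≤
      gTot n m q K θ η * ∏ j, (∫⁻ x, σ j x * g j x ^ q j) ^ ((∑ i, (q i)⁻¹)⁻¹ / q j) := by
  have hqi : ∀ j, 0 < 1 - (q j)⁻¹ := fun j => by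
    have := inv_lt_one_of_one_lt₀ (hq j); linarith
  have hP := (gGam_pos hm q hq).1
  have hp := inv_pos.2 hP
  set F : Fin m → En n → ℝ≥0∞ := fun j y => ENNReal.ofReal |f j y| with hF
  set P := ∑ i, (q i)⁻¹ with hPd
  set T := ∏ j, (∫⁻ x, σ j x * g j x ^ q j) ^ (P⁻¹ / q j) with hT
  have hv0 : ∀ N e a, volume (gQ n N e a) ≠ 0 := fun N e a => by
    rw [gQ_vol]; exact pow_ne_zero _ (by simpa using gSide_pos _ _)
  have hvt : ∀ N e a, volume (gQ n N e a) ≠ ⊤ := fun N e a => by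
    rw [gQ_vol]; exact ENNReal.pow_ne_top ENNReal.ofReal_ne_top
  have main : ∀ N e, ∫⁻ x, gSup n N e F x ^ P⁻¹ * ν x ≤ cGrid q (K * gTheta m N θ) * T := by
    intro N e
    refine grid_main (gQ_grid n N e) volume hm q hq ν σ F g hν hσ hg hgt hfg h1 (hv0 N e) (hvt N e)
      ?_ ?_ ?_ _ ?_
    · intro a j h
      rw [lintegral_eq_zero_iff (hσ j)] at h
      have : ∀ᵐ x ∂(volume.restrict (gQ n N e a)), False := by
        filter_upwards [h] with x hx using hs0 j x hx
      rw [Filter.eventually_false_iff_eq_bot, ae_eq_bot, Measure.restrict_eq_zero] at this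
      exact hv0 N e a this
    · intro a j
      obtain ⟨x, hx⟩ := gQ_sub_cube n N e a
      exact ne_top_of_le_ne_top (hst x _ (gSide_pos _ _) j) (lintegral_mono_set hx)
    · intro a j
      obtain ⟨x, hx⟩ := gQ_sub_cube n N e a
      exact ne_top_of_le_ne_top (hfin x _ (gSide_pos _ _) j) (lintegral_mono_set hx)
    · intro a
      obtain ⟨x, hx⟩ := gQ_sub_cube n N e a
      calc _ ≤ (∫⁻ y in cube x (gSide N a.1), ν y) ^ P *
            ∏ j, (∫⁻ y in cube x (gSide N a.1), σ j y) ^ (1 - (q j)⁻¹) := by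
            refine mul_le_mul' (ENNReal.rpow_le_rpow (lintegral_mono_set hx) hP.le)
              (Finset.prod_le_prod' fun j _ =>
                ENNReal.rpow_le_rpow (lintegral_mono_set hx) (hqi j).le)
        _ ≤ _ := hK x _ (gSide_pos _ _)
        _ ≤ K * (ENNReal.ofReal ((2 ^ (N + 1)) ^ θ) * volume (gQ n N e a)) ^ m := by
            rw [vol_cube x (gSide_pos _ _), gQ_vol]
            refine mul_le_mul_right (pow_le_pow_left' (mul_le_mul_left ?_ _) m) _
            apply ENNReal.ofReal_le_ofReal
            apply Real.rpow_le_rpow _ _ hθ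
            · linarith [gSide_pos N a.1]
            · have := gSide_le N a.1
              have h1 : (1:ℝ) ≤ 2 ^ N := one_le_pow₀ (by norm_num)
              rw [pow_succ]; linarith
        _ = _ := by unfold gTheta; rw [mul_pow, mul_assoc]
  calc ∫⁻ x, multiMax n m η f x ^ P⁻¹ * ν x
      ≤ ∫⁻ x, ∑' N : ℕ, ∑ e : Fin n → Bool,
        (ENNReal.ofReal (gD n N η) ^ m) ^ P⁻¹ * (gSup n N e F x ^ P⁻¹ * ν x) := by
        refine lintegral_mono fun x => ?_
        refine (mul_le_mul_left (multiMax_le n m hη hp f x) (ν x)).trans_eq ?_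
        rw [← ENNReal.tsum_mul_right]
        refine tsum_congr fun N => ?_
        rw [Finset.sum_mul]
        exact Finset.sum_congr rfl fun e _ => by rw [mul_assoc]
    _ = ∑' N : ℕ, ∑ e : Fin n → Bool, (ENNReal.ofReal (gD n N η) ^ m) ^ P⁻¹ *
          ∫⁻ x, gSup n N e F x ^ P⁻¹ * ν x := by
        have hmm : ∀ N e, Measurable fun x => gSup n N e F x ^ P⁻¹ * ν x := fun N e =>
          ((gSup_meas n N e F).pow_const _).mul hν
        rw [lintegral_tsum fun N => (Finset.measurable_fun_sum _ fun e _ =>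
          (hmm N e).const_mul _).aemeasurable]
        refine tsum_congr fun N => ?_
        rw [lintegral_finsetSum _ fun e _ => (hmm N e).const_mul _]
        exact Finset.sum_congr rfl fun e _ => lintegral_const_mul _ (hmm N e)
    _ ≤ ∑' N : ℕ, ∑ e : Fin n → Bool, (ENNReal.ofReal (gD n N η) ^ m) ^ P⁻¹ *
          (cGrid q (K * gTheta m N θ) * T) := by
        refine ENNReal.tsum_le_tsum fun N => Finset.sum_le_sum fun e _ =>
          mul_le_mul_right (main N e) _
    _ = _ := by
        unfold gTot
        rw [← ENNReal.tsum_mul_right]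
        refine tsum_congr fun N => ?_
        rw [Finset.sum_mul]
        exact Finset.sum_congr rfl fun e _ => by rw [mul_assoc]

lemma gTot_ne_top (n m : ℕ) (hm : 1 ≤ m) (q : Fin m → ℝ) (hq : ∀ j, 1 < q j) {K : ℝ≥0∞}
    (hK : K ≠ ⊤) {θ η : ℝ} (hη : η * m * (∑ i, (q i)⁻¹)⁻¹ = θ * m * gGam q + 1) :
    gTot n m q K θ η ≠ ⊤ := by
  obtain ⟨hP, hγ⟩ := gGam_pos hm q hq
  have hp := inv_pos.2 hP
  unfold gTot
  set P := ∑ i, (q i)⁻¹ with hPd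
  set γ := gGam q with hγd
  set A : ℝ := 6 ^ (θ * m * γ + 1) * (6 ^ n) ^ (m * P⁻¹) * 2 ^ (θ * m * γ) with hA
  have key : ∀ N : ℕ, (ENNReal.ofReal (gD n N η) ^ m) ^ P⁻¹ * gTheta m N θ ^ γ =
      ENNReal.ofReal A * (2⁻¹) ^ N := by
    intro N
    have hD : 0 < gD n N η := by unfold gD; positivity
    have h2 : (0:ℝ) < (2 ^ (N + 1)) ^ θ := by positivity
    unfold gTheta
    rw [← ENNReal.rpow_natCast, ← ENNReal.rpow_natCast, ← ENNReal.rpow_mul, ← ENNReal.rpow_mul,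
      ENNReal.ofReal_rpow_of_pos hD, ENNReal.ofReal_rpow_of_pos h2,
      ← ENNReal.ofReal_mul (by positivity)]
    have h22 : (2:ℝ≥0∞)⁻¹ ^ N = ENNReal.ofReal ((2⁻¹:ℝ) ^ N) := by
      rw [ENNReal.ofReal_pow (by norm_num), ENNReal.ofReal_inv_of_pos (by norm_num)]; simp
    rw [h22, ← ENNReal.ofReal_mul (by positivity)]
    congr 1
    unfold gD
    rw [Real.mul_rpow (by positivity) (by positivity), ← Real.rpow_mul (by positivity),
      ← Real.rpow_mul (by positivity), ← mul_assoc η, hη, Real.div_rpow (by norm_num) (by positivity),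
      pow_succ, ← mul_assoc θ, Real.mul_rpow (by positivity) (by norm_num), hA,
      Real.rpow_add (by positivity) (θ * m * γ) 1, Real.rpow_one, inv_pow]
    field_simp
    rw [mul_comm θ, Real.rpow_add (by positivity), Real.rpow_one]; ring
  have : ∀ N : ℕ, ∑ _e : Fin n → Bool, (ENNReal.ofReal (gD n N η) ^ m) ^ P⁻¹ *
      cGrid q (K * gTheta m N θ) = (2 ^ n * (cGrid q K * ENNReal.ofReal A)) * (2⁻¹) ^ N := by
    intro N
    rw [cGrid_mul hm q hq, ← mul_assoc, mul_comm _ (cGrid q K), mul_assoc, key]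
    simp; ring
  simp_rw [this]
  rw [ENNReal.tsum_mul_left]
  refine ENNReal.mul_ne_top (ENNReal.mul_ne_top (ENNReal.pow_ne_top (by simp))
    (ENNReal.mul_ne_top (cGrid_ne_top hm q hq hK) ENNReal.ofReal_ne_top)) ?_
  rw [ENNReal.tsum_geometric]
  simp

lemma ap_scale {m : ℕ} (q : Fin m → ℝ) (hq : ∀ j, 1 < q j) (hP : 0 < ∑ i, (q i)⁻¹)
    {B I K : ℝ≥0∞} (S : Fin m → ℝ≥0∞) (hB0 : B ≠ 0) (hBt : B ≠ ⊤)
    (h : (B⁻¹ * I) ^ (∑ i, (q i)⁻¹) * ∏ j, (B⁻¹ * S j) ^ (1 - (q j)⁻¹) ≤ K) :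
    I ^ (∑ i, (q i)⁻¹) * ∏ j, S j ^ (1 - (q j)⁻¹) ≤ K * B ^ m := by
  have hqi : ∀ j, 0 < 1 - (q j)⁻¹ := fun j => by
    have := inv_lt_one_of_one_lt₀ (hq j); linarith
  have e1 : (B⁻¹ * I) ^ (∑ i, (q i)⁻¹) * ∏ j, (B⁻¹ * S j) ^ (1 - (q j)⁻¹) =
      B⁻¹ ^ m * (I ^ (∑ i, (q i)⁻¹) * ∏ j, S j ^ (1 - (q j)⁻¹)) := by
    rw [ENNReal.mul_rpow_of_nonneg _ _ hP.le,
      Finset.prod_congr rfl fun j _ => ENNReal.mul_rpow_of_nonneg B⁻¹ (S j) (hqi j).le,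
      Finset.prod_mul_distrib, prod_rpow_exp _ _ _ fun j _ => (hqi j).le]
    have : B⁻¹ ^ m = B⁻¹ ^ (∑ i, (q i)⁻¹) * B⁻¹ ^ ∑ i, (1 - (q i)⁻¹) := by
      rw [← ENNReal.rpow_add_of_nonneg _ _ hP.le (Finset.sum_nonneg fun j _ => (hqi j).le),
        ← Finset.sum_add_distrib]
      simp
    rw [this]; ring
  rw [e1] at h
  have h2 := mul_le_mul_left h (B ^ m)
  refine le_trans (le_of_eq ?_) h2
  have : B⁻¹ ^ m * B ^ m = 1 := by
    rw [← mul_pow, ENNReal.inv_mul_cancel hB0 hBt, one_pow]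
  calc _ = (B⁻¹ ^ m * B ^ m) * (I ^ (∑ i, (q i)⁻¹) * ∏ j, S j ^ (1 - (q j)⁻¹)) := by
        rw [this, one_mul]
    _ = _ := by ring

lemma pt_f {W a q : ℝ} (hW : 0 < W) (hq : 1 < q) :
    ENNReal.ofReal |a| = ENNReal.ofReal W ^ (1 - q / (q - 1)) *
      ENNReal.ofReal (|a| * W ^ (1 / (q - 1))) := by
  have : q - 1 ≠ 0 := by linarith
  rw [ENNReal.ofReal_rpow_of_pos hW, ← ENNReal.ofReal_mul (by positivity)]
  congr 1
  rw [mul_left_comm, ← Real.rpow_add hW,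
    show 1 - q / (q - 1) + 1 / (q - 1) = 0 by field_simp; ring]
  simp

lemma pt_g {W a q : ℝ} (hW : 0 < W) (hq : 1 < q) :
    ENNReal.ofReal W ^ (1 - q / (q - 1)) * ENNReal.ofReal (|a| * W ^ (1 / (q - 1))) ^ q =
      ENNReal.ofReal (|a| ^ q * W) := by
  have : q - 1 ≠ 0 := by linarith
  rw [ENNReal.ofReal_rpow_of_pos hW, ENNReal.ofReal_rpow_of_nonneg (by positivity) (by linarith),
    ← ENNReal.ofReal_mul (by positivity)]
  congr 1
  rw [Real.mul_rpow (by positivity) (by positivity), mul_left_comm, ← Real.rpow_mul hW.le,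
    ← Real.rpow_add hW, show 1 - q / (q - 1) + 1 / (q - 1) * q = 1 by field_simp; ring]
  simp

lemma pt_one {m : ℕ} (q : Fin m → ℝ) (hq : ∀ j, 1 < q j) (hP : 0 < ∑ i, (q i)⁻¹)
    (W : Fin m → ℝ) (hW : ∀ j, 0 < W j) :
    1 ≤ ENNReal.ofReal (∏ j, W j ^ ((∑ i, (q i)⁻¹)⁻¹ / q j)) ^ (∑ i, (q i)⁻¹) *
      ∏ j, (ENNReal.ofReal (W j) ^ (1 - q j / (q j - 1))) ^ (1 - (q j)⁻¹) := by
  have hq0 : ∀ j, 0 < q j := fun j => by linarith [hq j]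
  set P := ∑ i, (q i)⁻¹ with hPd
  rw [ENNReal.ofReal_prod_of_nonneg fun j _ => (Real.rpow_pos_of_pos (hW j) _).le,
    ← ENNReal.prod_rpow_of_nonneg hP.le, ← Finset.prod_mul_distrib]
  refine le_of_eq (Finset.prod_eq_one fun j _ => ?_).symm
  have h1 : q j - 1 ≠ 0 := by linarith [hq j]
  have h2 := (hq0 j).ne'
  have h3 := hP.ne'
  rw [← ENNReal.rpow_mul, ← ENNReal.ofReal_rpow_of_pos (hW j), ← ENNReal.rpow_mul,
    ← ENNReal.rpow_add _ _ (by simpa using hW j) ENNReal.ofReal_ne_top,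
    show P⁻¹ / q j * P + (1 - q j / (q j - 1)) * (1 - (q j)⁻¹) = 0 by field_simp; ring]
  simp

lemma cube_sub {n : ℕ} (x : En n) {r R : ℝ} (h : 2 * ‖x‖ + r ≤ R) :
    cube x r ⊆ cube 0 R := by
  intro y hy l
  have hy' : ∀ l, |y l - x l| ≤ r / 2 := hy
  have h1 := hy' l
  have h2 : |x l| ≤ ‖x‖ := PiLp.norm_apply_le x l
  have h3 : |y l| ≤ |y l - x l| + |x l| := by simpa using abs_add_le (y l - x l) (x l)
  simp only [PiLp.zero_apply, sub_zero]
  linarith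

lemma mem_cube_zero {n : ℕ} (x : En n) {R : ℝ} (h : 2 * ‖x‖ ≤ R) : x ∈ cube (0 : En n) R := by
  intro l
  have h2 : |x l| ≤ ‖x‖ := PiLp.norm_apply_le x l
  simp only [PiLp.zero_apply, sub_zero]
  linarith

lemma iUnion_cube (n : ℕ) : (⋃ k : ℕ, cube (0 : En n) (k + 1)) = univ := by
  refine eq_univ_of_forall fun x => ?_
  obtain ⟨k, hk⟩ := exists_nat_ge (2 * ‖x‖)
  exact mem_iUnion.2 ⟨k, mem_cube_zero x (by linarith)⟩

lemma ae_of_cubes {n : ℕ} {Pr : En n → Prop}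
    (h : ∀ k : ℕ, ∀ᵐ x ∂(volume.restrict (cube (0 : En n) (k + 1))), Pr x) : ∀ᵐ x, Pr x := by
  rw [← Measure.restrict_univ (μ := (volume : Measure (En n))), ← iUnion_cube n,
    ae_restrict_iUnion_iff]
  exact h

lemma le_one_add_rpow (g : ℝ≥0∞) {q : ℝ} (hq : 1 < q) : g ≤ 1 + g ^ q := by
  rcases le_total g 1 with h | h
  · exact h.trans le_self_add
  · have := ENNReal.rpow_le_rpow_of_exponent_le h hq.le
    rw [ENNReal.rpow_one] at this
    exact this.trans le_add_self

lemma factor_ne_top {m : ℕ} (S : Fin m → ℝ≥0∞) (h0 : ∀ j, S j ≠ 0) (h : ∏ j, S j ≠ ⊤) (j : Fin m) :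
    S j ≠ ⊤ := by
  intro hj
  apply h
  rw [← Finset.mul_prod_erase _ _ (Finset.mem_univ j), hj]
  exact ENNReal.top_mul (Finset.prod_ne_zero_iff.2 fun i _ => h0 i)

theorem core {n m : ℕ} (hm : 1 ≤ m) (q : Fin m → ℝ) (hq : ∀ j, 1 < q j)
    {θ η : ℝ} (hθ : 0 ≤ θ) (hη : 0 ≤ η) (w : Fin m → En n → ℝ)
    (hwm : ∀ j, Measurable (w j)) (K : ℝ≥0∞) (hKt : K ≠ ⊤)
    (hK : ∀ x r, 0 < r → (∫⁻ y in cube x r, ENNReal.ofReal (nuW q w y)) ^ (∑ i, (q i)⁻¹) *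
      ∏ j, (∫⁻ y in cube x r, ENNReal.ofReal (w j y) ^ (1 - q j / (q j - 1))) ^ (1 - (q j)⁻¹) ≤
        K * (ENNReal.ofReal ((1 + r) ^ θ) * volume (cube x r)) ^ m)
    (f : Fin m → En n → ℝ) (hf : ∀ j, Measurable (f j)) {A : ℝ≥0∞} (hA : A ≠ 0)
    (hAg : gTot n m q K θ η ≤ A) :
    ∫⁻ x, multiMax n m η f x ^ (∑ i, (q i)⁻¹)⁻¹ * ENNReal.ofReal (nuW q w x) ≤
      A * ∏ j, (∫⁻ x, ENNReal.ofReal (|f j x| ^ q j * w j x)) ^ ((∑ i, (q i)⁻¹)⁻¹ / q j) := by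
  have hqi : ∀ j, 0 < 1 - (q j)⁻¹ := fun j => by
    have := inv_lt_one_of_one_lt₀ (hq j); linarith
  have hq0 : ∀ j, 0 < q j := fun j => by linarith [hq j]
  have hP := (gGam_pos hm q hq).1
  have hp := inv_pos.2 hP
  set P := ∑ i, (q i)⁻¹ with hPd
  set ν : En n → ℝ≥0∞ := fun x => ENNReal.ofReal (nuW q w x) with hνd
  set σ : Fin m → En n → ℝ≥0∞ := fun j x => ENNReal.ofReal (w j x) ^ (1 - q j / (q j - 1)) with hσd
  set g : Fin m → En n → ℝ≥0∞ := fun j x =>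
    ENNReal.ofReal (|f j x| * w j x ^ (1 / (q j - 1))) with hgd
  have hν : Measurable ν := by
    apply ENNReal.measurable_ofReal.comp
    unfold nuW
    exact Finset.measurable_fun_prod _ fun j _ => (hwm j).pow_const _
  have hσ : ∀ j, Measurable (σ j) := fun j =>
    (ENNReal.measurable_ofReal.comp (hwm j)).pow_const _
  have hg : ∀ j, Measurable (g j) := fun j =>
    ENNReal.measurable_ofReal.comp ((hf j).abs.mul ((hwm j).pow_const _))
  have hexp : ∀ j, 1 - q j / (q j - 1) < 0 := fun j => by
    have : 0 < q j - 1 := by linarith [hq j]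
    have : 1 < q j / (q j - 1) := by rw [lt_div_iff₀ this]; linarith
    linarith
  have hs0 : ∀ j x, σ j x ≠ 0 := fun j x => by
    simp only [hσd, Ne, ENNReal.rpow_eq_zero_iff, ENNReal.ofReal_ne_top, false_and, or_false]
    intro h
    exact absurd h.2 (not_lt.2 (hexp j).le)
  by_cases hν0 : ∀ k : ℕ, ∫⁻ y in cube (0 : En n) (k + 1), ν y = 0
  · have : ∀ᵐ x, ν x = 0 := ae_of_cubes fun k => by
      have := (lintegral_eq_zero_iff hν).1 (hν0 k)
      exact this
    have h0 : ∫⁻ x, multiMax n m η f x ^ P⁻¹ * ν x = ∫⁻ x : En n, 0 := by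
      apply lintegral_congr_ae
      filter_upwards [this] with x hx
      rw [hx, mul_zero]
    rw [h0]; simp
  push Not at hν0
  obtain ⟨k0, hk0⟩ := hν0
  have hcs0 : ∀ x r, 0 < r → ∀ j, ∫⁻ y in cube x r, σ j y ≠ 0 := by
    intro x r hr j h
    rw [lintegral_eq_zero_iff (hσ j)] at h
    have : ∀ᵐ x ∂(volume.restrict (cube x r)), False := by
      filter_upwards [h] with x hx using hs0 j x hx
    rw [Filter.eventually_false_iff_eq_bot, ae_eq_bot, Measure.restrict_eq_zero, vol_cube x hr]
      at this
    exact pow_ne_zero _ (by simpa using hr) this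
  have hst : ∀ x r, 0 < r → ∀ j, ∫⁻ y in cube x r, σ j y ≠ ⊤ := by
    intro x r hr j
    set R : ℝ := (k0 + 1) + (2 * ‖x‖ + r) with hR
    have hx0 := norm_nonneg x
    have hRp : 0 < R := by positivity
    refine ne_top_of_le_ne_top ?_ (lintegral_mono_set (cube_sub x (R := R) (by
      rw [hR]; linarith [(Nat.cast_nonneg k0 : (0:ℝ) ≤ k0)])))
    have hνR : ∫⁻ y in cube (0 : En n) R, ν y ≠ 0 := by
      refine fun h => hk0 (le_antisymm ?_ zero_le)
      rw [← h]
      exact lintegral_mono_set fun y hy l => (hy l).trans (by rw [hR]; linarith)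
    have hKR := hK 0 R hRp
    have hfinR : K * (ENNReal.ofReal ((1 + R) ^ θ) * volume (cube (0 : En n) R)) ^ m ≠ ⊤ := by
      rw [vol_cube _ hRp]
      exact ENNReal.mul_ne_top hKt (ENNReal.pow_ne_top (ENNReal.mul_ne_top ENNReal.ofReal_ne_top
        (ENNReal.pow_ne_top ENNReal.ofReal_ne_top)))
    have hprod := ne_top_of_le_ne_top hfinR hKR
    have hν1 : (∫⁻ y in cube (0 : En n) R, ν y) ^ P ≠ 0 := by
      simp only [Ne, ENNReal.rpow_eq_zero_iff, hνR, false_and, false_or]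
      intro h; linarith [h.2]
    have hpt : ∏ j, (∫⁻ y in cube (0 : En n) R, σ j y) ^ (1 - (q j)⁻¹) ≠ ⊤ := by
      intro h
      apply hprod
      rw [h]
      exact ENNReal.mul_top hν1
    have := factor_ne_top _ (fun j => by
      simp only [Ne, ENNReal.rpow_eq_zero_iff, hcs0 0 R hRp j, false_and, false_or]
      intro h; linarith [h.2, hqi j]) hpt j
    intro h
    apply this
    rw [h, ENNReal.top_rpow_of_pos (hqi j)]
  have hwpos : ∀ j, ∀ᵐ x, 0 < w j x := fun j => ae_of_cubes fun k => by
    have := ae_lt_top (hσ j) (hst 0 (k + 1) (by positivity) j)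
    filter_upwards [this] with x hx
    by_contra hc
    have h0 : ENNReal.ofReal (w j x) = 0 := ENNReal.ofReal_eq_zero.2 (not_lt.1 hc)
    simp only [hσd, h0, ENNReal.zero_rpow_of_neg (hexp j), lt_self_iff_false] at hx
  have hfg : ∀ j, ∀ᵐ x, ENNReal.ofReal |f j x| = σ j x * g j x := fun j => by
    filter_upwards [hwpos j] with x hx using pt_f hx (hq j)
  have hsg : ∀ j, ∫⁻ x, σ j x * g j x ^ q j = ∫⁻ x, ENNReal.ofReal (|f j x| ^ q j * w j x) :=
    fun j => by
      apply lintegral_congr_ae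
      filter_upwards [hwpos j] with x hx using pt_g hx (hq j)
  have h1 : ∀ᵐ x, 1 ≤ ν x ^ P * ∏ j, σ j x ^ (1 - (q j)⁻¹) := by
    filter_upwards [ae_all_iff.2 hwpos] with x hx using pt_one q hq hP (fun j => w j x) hx
  by_cases hz : ∃ j, ∫⁻ x, ENNReal.ofReal (|f j x| ^ q j * w j x) = 0
  · obtain ⟨j, hj⟩ := hz
    have hjm : Measurable fun x => ENNReal.ofReal (|f j x| ^ q j * w j x) :=
      ENNReal.measurable_ofReal.comp (((hf j).abs.pow_const _).mul (hwm j))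
    rw [lintegral_eq_zero_iff hjm] at hj
    have hfz : ∀ᵐ x, ENNReal.ofReal |f j x| = 0 := by
      filter_upwards [hj, hwpos j] with x hx hx2
      have h3 : |f j x| ^ q j * w j x ≤ 0 := ENNReal.ofReal_eq_zero.1 hx
      rw [ENNReal.ofReal_eq_zero]
      by_contra hc
      have : 0 < |f j x| ^ q j * w j x := mul_pos (Real.rpow_pos_of_pos (not_le.1 hc) _) hx2
      linarith
    have hM : ∀ x, multiMax n m η f x = 0 := by
      intro x
      unfold multiMax
      simp only [ENNReal.iSup_eq_zero]
      intro c r hr hx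
      refine Finset.prod_eq_zero (Finset.mem_univ j) ?_
      rw [lintegral_congr_ae (ae_restrict_of_ae hfz)]
      simp
    simp [hM, ENNReal.zero_rpow_of_pos hp]
  push Not at hz
  by_cases ht : ∃ j, ∫⁻ x, ENNReal.ofReal (|f j x| ^ q j * w j x) = ⊤
  · obtain ⟨j, hj⟩ := ht
    have : ∏ j, (∫⁻ x, ENNReal.ofReal (|f j x| ^ q j * w j x)) ^ (P⁻¹ / q j) = ⊤ := by
      rw [← Finset.mul_prod_erase _ _ (Finset.mem_univ j), hj,
        ENNReal.top_rpow_of_pos (div_pos hp (hq0 j))]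
      refine ENNReal.top_mul (Finset.prod_ne_zero_iff.2 fun i _ => ?_)
      simp only [Ne, ENNReal.rpow_eq_zero_iff, hz i, false_and, false_or]
      intro h; linarith [h.2, div_pos hp (hq0 i)]
    rw [this, ENNReal.mul_top hA]
    exact le_top
  push Not at ht
  have hfin : ∀ x r, 0 < r → ∀ j, ∫⁻ y in cube x r, ENNReal.ofReal |f j y| ≠ ⊤ := by
    intro x r hr j
    have : ∫⁻ y in cube x r, ENNReal.ofReal |f j y| ≤
        (∫⁻ y in cube x r, σ j y) + ∫⁻ x, ENNReal.ofReal (|f j x| ^ q j * w j x) := by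
      calc _ = ∫⁻ y in cube x r, σ j y * g j y :=
            lintegral_congr_ae (ae_restrict_of_ae (hfg j))
        _ ≤ ∫⁻ y in cube x r, σ j y + σ j y * g j y ^ q j := by
            refine lintegral_mono fun y => ?_
            calc _ ≤ σ j y * (1 + g j y ^ q j) := mul_le_mul_right (le_one_add_rpow _ (hq j)) _
              _ = _ := by rw [mul_add, mul_one]
        _ = (∫⁻ y in cube x r, σ j y) + ∫⁻ y in cube x r, σ j y * g j y ^ q j :=
            lintegral_add_left (hσ j) _
        _ ≤ _ := by
            rw [← hsg j]
            exact add_le_add le_rfl (setLIntegral_le_lintegral _ _)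
    exact ne_top_of_le_ne_top (ENNReal.add_ne_top.2 ⟨hst x r hr j, ht j⟩) this
  have := full_main hm q hq hθ hη f ν σ g hν hσ hg (fun j x => ENNReal.ofReal_ne_top) hfg h1 hs0
    hst hfin K hK
  simp only [hsg] at this
  exact this.trans (mul_le_mul_left hAg _)

lemma nuW_congr {n m : ℕ} (q : Fin m → ℝ) {w w' : Fin m → En n → ℝ}
    (h : ∀ j, w j =ᵐ[volume] w' j) : ∀ᵐ x, nuW q w x = nuW q w' x := by
  filter_upwards [ae_all_iff.2 h] with x hx
  unfold nuW
  exact Finset.prod_congr rfl fun j _ => by rw [hx j]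

/-- Lemma 2.6: strong weighted boundedness of the multilinear maximal operator
`𝓜_{φ,η₀}` for `ω⃗ ∈ A_{p⃗}^∞(φ)` with all `p_j > 1`. -/
theorem stmt15 (n m : ℕ) (hn : 0 < n) (hm : 1 ≤ m) (p : Fin m → ℝ)
    (hp : ∀ j, 1 < p j) (w : Fin m → En n → ℝ)
    (hw : ∃ θ ≥ 0, MultiApTheta n m p θ w) :
    ∃ η₀ > 0, ∃ C > 0, ∀ f : Fin m → En n → ℝ, (∀ j, Measurable (f j)) →
      wLpE n (∑ j, (p j)⁻¹)⁻¹ (nuW p w) (multiMax n m η₀ f) ≤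
        ENNReal.ofReal C * ∏ j, wLp (p j) (w j) (f j) := by
  obtain ⟨θ, hθ, -, hloc, C, hC, hAp⟩ := hw
  obtain ⟨hP, hγ⟩ := gGam_pos hm p hp
  have hq0 : ∀ j, 0 < p j := fun j => by linarith [hp j]
  have hPi := inv_pos.2 hP
  have hm0 : (0:ℝ) < m := by exact_mod_cast hm
  have hae : ∀ j, AEStronglyMeasurable (w j) volume := fun j => (hloc j).aestronglyMeasurable
  set w' : Fin m → En n → ℝ := fun j => (hae j).mk (w j) with hw'
  have hww : ∀ j, w j =ᵐ[volume] w' j := fun j => (hae j).ae_eq_mk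
  have hwm : ∀ j, Measurable (w' j) := fun j => (hae j).stronglyMeasurable_mk.measurable
  have hnu := nuW_congr p hww
  set η : ℝ := (θ * m * gGam p + 1) / (m * (∑ j, (p j)⁻¹)⁻¹) with hη
  have hη0 : 0 < η := by positivity
  have hηe : η * m * (∑ i, (p i)⁻¹)⁻¹ = θ * m * gGam p + 1 := by
    rw [hη, mul_assoc, div_mul_cancel₀ _ (by positivity)]
  have hK : ∀ x r, 0 < r → (∫⁻ y in cube x r, ENNReal.ofReal (nuW p w' y)) ^ (∑ i, (p i)⁻¹) *
      ∏ j, (∫⁻ y in cube x r, ENNReal.ofReal (w' j y) ^ (1 - p j / (p j - 1))) ^ (1 - (p j)⁻¹) ≤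
        ENNReal.ofReal C * (ENNReal.ofReal ((1 + r) ^ θ) * volume (cube x r)) ^ m := by
    intro x r hr
    apply ap_scale p hp hP
    · rw [vol_cube x hr]
      refine mul_ne_zero ?_ (pow_ne_zero _ (by simpa using hr))
      simpa using Real.rpow_pos_of_pos (by linarith : 0 < 1 + r) θ
    · rw [vol_cube x hr]
      exact ENNReal.mul_ne_top ENNReal.ofReal_ne_top (ENNReal.pow_ne_top ENNReal.ofReal_ne_top)
    · have h := hAp x r hr
      have e1 : ∫⁻ y in cube x r, ENNReal.ofReal (nuW p w y) =
          ∫⁻ y in cube x r, ENNReal.ofReal (nuW p w' y) := by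
        apply lintegral_congr_ae
        filter_upwards [ae_restrict_of_ae hnu] with y hy
        rw [hy]
      have e2 : ∀ j, ∫⁻ y in cube x r, ENNReal.ofReal (w j y) ^ (1 - p j / (p j - 1)) =
          ∫⁻ y in cube x r, ENNReal.ofReal (w' j y) ^ (1 - p j / (p j - 1)) := fun j => by
        apply lintegral_congr_ae
        filter_upwards [ae_restrict_of_ae (hww j)] with y hy
        rw [hy]
      simp only [(hp _).ne', if_false, e1, e2] at h
      exact h
  have hG : gTot n m p (ENNReal.ofReal C) θ η ≠ ⊤ :=
    gTot_ne_top n m hm p hp ENNReal.ofReal_ne_top hηe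
  set A : ℝ≥0∞ := gTot n m p (ENNReal.ofReal C) θ η + 1 with hAd
  have hA0 : A ≠ 0 := by simp [hAd]
  have hAt : A ≠ ⊤ := ENNReal.add_ne_top.2 ⟨hG, by simp⟩
  have hAPt : A ^ (∑ j, (p j)⁻¹) ≠ ⊤ := ENNReal.rpow_ne_top_of_nonneg hP.le hAt
  refine ⟨η, hη0, (A ^ (∑ j, (p j)⁻¹)).toReal + 1, by positivity, fun f hf => ?_⟩
  have hc := core hm p hp hθ hη0.le w' hwm (ENNReal.ofReal C) ENNReal.ofReal_ne_top hK f hf hA0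
    (le_self_add : _ ≤ A)
  have i1 : ∫⁻ x, multiMax n m η f x ^ (∑ i, (p i)⁻¹)⁻¹ * ENNReal.ofReal (nuW p w x) =
      ∫⁻ x, multiMax n m η f x ^ (∑ i, (p i)⁻¹)⁻¹ * ENNReal.ofReal (nuW p w' x) := by
    apply lintegral_congr_ae
    filter_upwards [hnu] with y hy
    rw [hy]
  have i2 : ∀ j, ∫⁻ x, ENNReal.ofReal (|f j x| ^ p j * w j x) =
      ∫⁻ x, ENNReal.ofReal (|f j x| ^ p j * w' j x) := fun j => by
    apply lintegral_congr_ae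
    filter_upwards [hww j] with y hy
    rw [hy]
  unfold wLpE wLp
  rw [i1, one_div, inv_inv]
  calc _ ≤ (A * ∏ j, (∫⁻ x, ENNReal.ofReal (|f j x| ^ p j * w' j x)) ^
        ((∑ i, (p i)⁻¹)⁻¹ / p j)) ^ (∑ j, (p j)⁻¹) := ENNReal.rpow_le_rpow hc hP.le
    _ = A ^ (∑ j, (p j)⁻¹) *
        ∏ j, (∫⁻ x, ENNReal.ofReal (|f j x| ^ p j * w j x)) ^ (1 / p j) := by
        rw [ENNReal.mul_rpow_of_nonneg _ _ hP.le, ← ENNReal.prod_rpow_of_nonneg hP.le]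
        congr 1
        refine Finset.prod_congr rfl fun j _ => ?_
        rw [← ENNReal.rpow_mul, i2]
        congr 1
        rw [div_mul_eq_mul_div, inv_mul_cancel₀ hP.ne']
    _ ≤ _ := by
        refine mul_le_mul_left ?_ _
        rw [ENNReal.ofReal_add (by positivity) (by norm_num), ENNReal.ofReal_toReal hAPt]
        exact le_self_add

end
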